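/- Fix d ≥ 1 and E > 0, and let a₀ : ℝ^{2d} → ℝ be a smooth function all of whose partial derivatives (including a₀ itself) are bounded. Then lim_{N→∞} C(N+d−1, d−1)^{−1} ∫_{ℝ^{2d}} a₀(x,ξ) W_{ħ_N(E),N}(x,ξ) dx dξ = σ_E(Σ_E)^{−1} ∫_{Σ_E} a₀ dσ_E, where Σ_E = {(x,ξ) ∈ ℝ^d × ℝ^d : |x|² + |ξ|² = 2E} and σ_E is the (2d−1)-dimensional surface (Hausdorff) measure on Σ_E. That is, the normalized Wigner distributions of the eigenspace projections converge weak* to normalized Liouville measure on the energy surface Σ_E. -/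

import Mathlib

open MeasureTheory Real Filter
open scoped BigOperators ENNReal

noncomputable section

/-- Physicists' Hermite polynomials `H_n`. -/
def physHermite : ℕ → Polynomial ℝ
  | 0 => 1
  | n + 1 => 2 * Polynomial.X * physHermite n - Polynomial.derivative (physHermite n)

/-- The `L²`-normalized Hermite function `φ_n`. -/
def hermiteFun (n : ℕ) (t : ℝ) : ℝ :=
  ((2 : ℝ) ^ n * (n.factorial : ℝ) * Real.sqrt π) ^ (-(1 : ℝ) / 2) *
    (physHermite n).eval t * Real.exp (-t ^ 2 / 2)

/-- The product Hermite function `φ_α` on `ℝ^d`. -/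
def hermiteProd {d : ℕ} (α : Fin d → ℕ) (x : Fin d → ℝ) : ℝ :=
  ∏ j, hermiteFun (α j) (x j)

/-- The rescaled Hermite eigenfunction `φ_{α,hb}(x) = hb^{-d/4} φ_α(hb^{-1/2} x)`. -/
def hermiteProdH {d : ℕ} (hb : ℝ) (α : Fin d → ℕ) (x : Fin d → ℝ) : ℝ :=
  hb ^ (-(d : ℝ) / 4) * hermiteProd α fun j => hb ^ (-(1 : ℝ) / 2) * x j

/-- The eigenspace projection kernel `Π_{hb,N}(x,y) = Σ_{|α|=N} φ_{α,hb}(x) φ_{α,hb}(y)`. -/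
def projKer (d : ℕ) (hb : ℝ) (N : ℕ) (x y : Fin d → ℝ) : ℝ :=
  ∑ α ∈ Finset.Nat.antidiagonalTuple d N, hermiteProdH hb α x * hermiteProdH hb α y

/-- Euclidean dot product on `ℝ^d`. -/
def dotR {d : ℕ} (v ξ : Fin d → ℝ) : ℝ := ∑ j, v j * ξ j

/-- The Wigner distribution of the `N`-th eigenspace projection,
`W_{hb,N}(x,ξ) = (2πhb)^{-d} ∫ Π_{hb,N}(x+v/2, x-v/2) e^{-i v·ξ/hb} dv`. -/
def wigner (d : ℕ) (hb : ℝ) (N : ℕ) (x ξ : Fin d → ℝ) : ℂ :=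
  ((((2 * π * hb) ^ d)⁻¹ : ℝ) : ℂ) *
    ∫ v : Fin d → ℝ,
      ((projKer d hb N (fun j => x j + v j / 2) (fun j => x j - v j / 2) : ℝ) : ℂ) *
        Complex.exp (-Complex.I * (dotR v ξ : ℂ) / (hb : ℂ))

/-- The classical Hamiltonian `H(x,ξ) = (|x|² + |ξ|²)/2`. -/
def Hfun {d : ℕ} (x ξ : Fin d → ℝ) : ℝ := ((∑ j, x j ^ 2) + ∑ j, ξ j ^ 2) / 2

/-- `hb_N(E) = E/(N + d/2)`, so that `E_N(hb) = hb(N + d/2) = E`. -/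
def hPl (d : ℕ) (E : ℝ) (N : ℕ) : ℝ := E / ((N : ℝ) + (d : ℝ) / 2)

/-- The Airy function `Ai(s) = (1/π) lim_{T→∞} ∫_0^T cos(t³/3 + s t) dt`. -/
def airy (s : ℝ) : ℝ :=
  (1 / π) * limUnder Filter.atTop fun T : ℝ => ∫ t in (0 : ℝ)..T, Real.cos (t ^ 3 / 3 + s * t)

/-- The energy surface `Σ_E = {|x|² + |ξ|² = 2E}`, realized in `ℝ^{2d}`. -/
def energySurf (d : ℕ) (E : ℝ) : Set (EuclideanSpace ℝ (Fin (d + d))) :=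
  {q | ∑ i, q i ^ 2 = 2 * E}

/-- Identification of `ℝ^{2d}` with phase space `ℝ^d × ℝ^d`. -/
def splitPt (d : ℕ) (q : EuclideanSpace ℝ (Fin (d + d))) : (Fin d → ℝ) × (Fin d → ℝ) :=
  (fun i => q (Fin.castAdd d i), fun i => q (Fin.natAdd d i))

section
open MeasureTheory Real Filter
open scoped BigOperators ENNReal

lemma physHermite_succ (n : ℕ) : physHermite (n+1) =
    2 * Polynomial.X * physHermite n - Polynomial.derivative (physHermite n) := rfl

lemma physHermite_deriv (n : ℕ) : Polynomial.derivative (physHermite (n+1)) =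
    2 * ((n:Polynomial ℝ)+1) * physHermite n := by
  induction n with
  | zero => simp [physHermite]
  | succ n ih =>
    rw [physHermite_succ (n+1)]
    simp only [Polynomial.derivative_sub, Polynomial.derivative_mul, ih, Polynomial.derivative_X,
      Polynomial.derivative_ofNat, Polynomial.derivative_add, Polynomial.derivative_natCast,
      Polynomial.derivative_one]
    rw [physHermite_succ n]
    push_cast
    ring

lemma integrable_pow_gauss (b : ℝ) (hb : 0 < b) (k : ℕ) :
    Integrable (fun u : ℝ => u ^ k * Real.exp (-b * u ^ 2)) := by
  have := integrable_rpow_mul_exp_neg_mul_sq hb (s := k) (by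
    have : (0:ℝ) ≤ k := by positivity
    linarith)
  simpa [Real.rpow_natCast] using this

/-- gaussian functional -/
def gint (p : ℝ) (P : Polynomial ℂ) : ℂ :=
  ∫ u : ℝ, P.eval (u:ℂ) * Complex.exp (-(u:ℂ)^2 + Complex.I * p * u)

lemma gint_integrable (p : ℝ) (P : Polynomial ℂ) :
    Integrable (fun u : ℝ => P.eval (u:ℂ) * Complex.exp (-(u:ℂ)^2 + Complex.I * p * u)) := by
  have hcont : ∀ P : Polynomial ℂ, Continuous
      (fun u : ℝ => P.eval (u:ℂ) * Complex.exp (-(u:ℂ)^2 + Complex.I * p * u)) := by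
    intro P
    have : Continuous fun u : ℝ => P.eval (u:ℂ) := P.continuous.comp Complex.continuous_ofReal
    fun_prop
  induction P using Polynomial.induction_on' with
  | add P Q hP hQ =>
    refine (hP.add hQ).congr (ae_of_all _ fun u => ?_)
    simp [add_mul]
  | monomial k c =>
    refine ((integrable_pow_gauss 1 one_pos k).const_mul ‖c‖).mono (hcont _).aestronglyMeasurable
      (ae_of_all _ fun u => ?_)
    simp [Complex.norm_exp, ← Complex.ofReal_pow, mul_assoc]

lemma gint_add (p : ℝ) (P Q : Polynomial ℂ) : gint p (P + Q) = gint p P + gint p Q := by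
  unfold gint
  rw [← integral_add (gint_integrable p P) (gint_integrable p Q)]
  simp [add_mul]

lemma gint_C_mul (p : ℝ) (c : ℂ) (P : Polynomial ℂ) :
    gint p (Polynomial.C c * P) = c * gint p P := by
  unfold gint
  rw [← integral_const_mul]
  simp [mul_assoc]

lemma gint_ibp (p : ℝ) (P : Polynomial ℂ) :
    gint p (Polynomial.C 2 * Polynomial.X * P) =
      gint p (Polynomial.derivative P) + Complex.I * p * gint p P := by
  have key : gint p (Polynomial.derivative P + Polynomial.C (Complex.I * p) * P
      + Polynomial.C (-1) * (Polynomial.C 2 * Polynomial.X * P)) = 0 := by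
    refine integral_eq_zero_of_hasDerivAt_of_integrable
      (f := fun u : ℝ => P.eval (u:ℂ) * Complex.exp (-(u:ℂ)^2 + Complex.I * p * u)) ?_
      (gint_integrable p _) (gint_integrable p P)
    intro u
    have h1 : HasDerivAt (fun z : ℂ => P.eval z * Complex.exp (-z^2 + Complex.I * p * z))
        ((Polynomial.derivative P).eval (u:ℂ) * Complex.exp (-(u:ℂ)^2 + Complex.I * p * u) +
          P.eval (u:ℂ) * (Complex.exp (-(u:ℂ)^2 + Complex.I * p * u) *
            (-(2 * (u:ℂ)) + Complex.I * p))) (u:ℂ) := by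
      refine (P.hasDerivAt _).mul (HasDerivAt.cexp ?_)
      exact ((hasDerivAt_pow 2 (u:ℂ)).neg.add
        ((hasDerivAt_id (u:ℂ)).const_mul (Complex.I * p))).congr_deriv (by simp)
    refine h1.comp_ofReal.congr_deriv ?_
    simp
    ring
  rw [gint_add, gint_add, gint_C_mul, gint_C_mul] at key
  linear_combination -key

/-- shifted hermite -/
def hsh (n : ℕ) (a : ℂ) : Polynomial ℂ :=
  ((physHermite n).map Complex.ofRealHom).comp (Polynomial.X + Polynomial.C a)

lemma hsh_zero (a : ℂ) : hsh 0 a = 1 := by simp [hsh, physHermite]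

lemma hsh_deriv (n : ℕ) (a : ℂ) : Polynomial.derivative (hsh (n+1) a) =
    Polynomial.C (2 * ((n:ℂ)+1)) * hsh n a := by
  unfold hsh
  rw [Polynomial.derivative_comp, Polynomial.derivative_map, physHermite_deriv]
  have h2 : (Polynomial.C 2 : Polynomial ℂ) = 2 := rfl
  simp [h2]

lemma hsh_succ (n : ℕ) (a : ℂ) : hsh (n+1) a =
    Polynomial.C 2 * Polynomial.X * hsh n a + Polynomial.C (2*a) * hsh n a
      + Polynomial.C (-1) * Polynomial.derivative (hsh n a) := by
  unfold hsh
  rw [Polynomial.derivative_comp, Polynomial.derivative_map, physHermite_succ]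
  have h2 : (Polynomial.C 2 : Polynomial ℂ) = 2 := rfl
  simp [h2]
  ring

def TT (p : ℝ) (a b : ℂ) (m n : ℕ) : ℂ := gint p (hsh m a * hsh n b)

lemma TT_succ (p : ℝ) (a b : ℂ) (m n : ℕ) : TT p a b (m+1) n =
    gint p (hsh m a * Polynomial.derivative (hsh n b)) + (2 * a + Complex.I * p) * TT p a b m n := by
  unfold TT
  have : hsh (m+1) a * hsh n b = Polynomial.C 2 * Polynomial.X * (hsh m a * hsh n b) +
     Polynomial.C (2*a) * (hsh m a * hsh n b)
      + Polynomial.C (-1) * (Polynomial.derivative (hsh m a) * hsh n b) := by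
    rw [hsh_succ]; ring
  rw [this, gint_add, gint_add, gint_ibp, Polynomial.derivative_mul, gint_add, gint_C_mul, gint_C_mul]
  ring

lemma TT_comm (p : ℝ) (a b : ℂ) (m n : ℕ) : TT p a b m n = TT p b a n m := by
  unfold TT; rw [mul_comm]

lemma TT_zero (p : ℝ) (a b : ℂ) (n : ℕ) :
    TT p a b 0 n = (2 * b + Complex.I * p) ^ n * TT p a b 0 0 := by
  induction n with
  | zero => simp
  | succ n ih =>
    rw [TT_comm, TT_succ, hsh_zero]
    rw [TT_comm, ih]
    simp [gint]
    ring

lemma TT_succ' (p : ℝ) (a b : ℂ) (m n : ℕ) : TT p a b (m+1) n =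
    2 * n * TT p a b m (n-1) + (2 * a + Complex.I * p) * TT p a b m n := by
  rw [TT_succ]
  congr 1
  cases n with
  | zero => rw [hsh_zero]; simp [gint]
  | succ n =>
    rw [hsh_deriv]
    have : hsh m a * (Polynomial.C (2 * ((n:ℂ) + 1)) * hsh n b) =
      Polynomial.C (2 * ((n:ℂ) + 1)) * (hsh m a * hsh n b) := by ring
    rw [this, gint_C_mul]
    simp [TT]

lemma TT_formula (p : ℝ) (a b : ℂ) (m : ℕ) : ∀ n : ℕ, TT p a b m n =
    (∑ k ∈ Finset.range (m+1), (m.choose k : ℂ) * (2 * a + Complex.I * p) ^ (m - k) *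
      ((n.descFactorial k : ℂ) * 2 ^ k * (2 * b + Complex.I * p) ^ (n - k))) * TT p a b 0 0 := by
  induction m with
  | zero => intro n; simp; rw [TT_zero]
  | succ m ih =>
    intro n
    rw [TT_succ', ih, ih]
    set A := 2 * a + Complex.I * p
    set B := 2 * b + Complex.I * p
    set D : ℕ → ℂ := fun k => ((n.descFactorial k : ℂ) * 2 ^ k * B ^ (n - k)) with hD
    have h1 : ∀ k, 2 * (n:ℂ) * (((n-1).descFactorial k : ℂ) * 2 ^ k * B ^ (n - 1 - k)) = D (k+1) := by
      intro k
      cases n with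
      | zero => simp [hD]
      | succ n =>
        simp only [hD, Nat.succ_descFactorial_succ, Nat.add_sub_cancel, Nat.add_sub_add_right]
        push_cast
        ring
    have h2 : 2 * (n:ℂ) * (∑ k ∈ Finset.range (m+1), (m.choose k : ℂ) * A ^ (m - k) *
      (((n-1).descFactorial k : ℂ) * 2 ^ k * B ^ (n - 1 - k))) =
        ∑ k ∈ Finset.range (m+1), (m.choose k : ℂ) * A ^ (m - k) * D (k+1) := by
      rw [Finset.mul_sum]
      refine Finset.sum_congr rfl fun k _ => ?_
      rw [← h1]; ring
    have h3 : A * (∑ k ∈ Finset.range (m+1), (m.choose k : ℂ) * A ^ (m - k) * D k) =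
        A ^ (m+1) * D 0 + ∑ k ∈ Finset.range (m+1), (m.choose (k+1) : ℂ) * A ^ (m - k) * D (k+1) := by
      rw [Finset.sum_range_succ', Finset.sum_range_succ (n := m)]
      simp only [Nat.choose_succ_self, Nat.choose_zero_right, mul_add, Finset.mul_sum]
      simp
      rw [add_comm]
      congr 1
      · ring
      · refine Finset.sum_congr rfl fun k hk => ?_
        have hk : k < m := Finset.mem_range.1 hk
        have : m - k = (m - (k+1)) + 1 := by omega
        rw [this]; ring
    rw [Finset.sum_range_succ' (n := m+1)]
    simp only [Nat.choose_zero_right, Nat.sub_zero, Nat.add_sub_add_right, Nat.choose_succ_succ]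
    rw [← mul_assoc, h2, ← mul_assoc, h3, ← add_mul]
    congr 1
    rw [add_comm (A ^ (m+1) * D 0), ← add_assoc, ← Finset.sum_add_distrib]
    congr 1
    · refine Finset.sum_congr rfl fun k _ => ?_
      simp only [hD]
      push_cast
      ring
    · simp [hD]

end

section
open MeasureTheory Real Filter
open scoped BigOperators ENNReal

def lag (α n : ℕ) (y : ℝ) : ℝ :=
  ∑ j ∈ Finset.range (n+1), ((n+α).choose (n-j) : ℝ) * ((-y)^j / (j.factorial : ℝ))

def ell (n : ℕ) (y : ℝ) : ℝ := lag 0 n y * Real.exp (-y/2)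

lemma gauss00 (p : ℝ) (a b : ℂ) : TT p a b 0 0 = Real.sqrt π * Complex.exp (-(p:ℂ)^2/4) := by
  unfold TT gint
  simp only [hsh_zero]
  have := integral_cexp_quadratic (b := -1) (by simp) (Complex.I * p) 0
  simp only [neg_mul, one_mul, add_zero] at this
  simp only [mul_one, Polynomial.eval_one, one_mul]
  rw [this]
  have hs : ((π:ℂ) / - -1) ^ (1/2:ℂ) = Real.sqrt π := by
    rw [Real.sqrt_eq_rpow, Complex.ofReal_cpow Real.pi_pos.le]; simp
  rw [hs]
  congr 2
  rw [mul_pow, Complex.I_sq]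
  ring

lemma hconst (n : ℕ) : (((2 : ℝ) ^ n * (n.factorial : ℝ) * Real.sqrt π) ^ (-(1 : ℝ) / 2)) ^ 2 =
    ((2 : ℝ) ^ n * (n.factorial : ℝ) * Real.sqrt π)⁻¹ := by
  rw [← Real.rpow_natCast, ← Real.rpow_mul (by positivity)]
  norm_num
  rw [Real.rpow_neg_one]
  field_simp

lemma hprod_eq (n : ℕ) (p q u : ℝ) :
    ((hermiteFun n (u + q/2) * hermiteFun n (u - q/2) : ℝ) : ℂ) * Complex.exp (Complex.I * p * u) =
    ((((2 : ℝ) ^ n * (n.factorial : ℝ) * Real.sqrt π)⁻¹ * Real.exp (-q^2/4) : ℝ) : ℂ) *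
    ((hsh n ((q/2 : ℝ):ℂ) * hsh n ((-(q/2) : ℝ):ℂ)).eval (u:ℂ)
      * Complex.exp (-(u:ℂ)^2 + Complex.I * p * u)) := by
  have e : ∀ a : ℝ, (hsh n (a:ℂ)).eval (u:ℂ) = (((physHermite n).eval (u + a) : ℝ):ℂ) := by
    intro a
    simp only [hsh, Polynomial.eval_comp, Polynomial.eval_add, Polynomial.eval_X, Polynomial.eval_C]
    rw [← Complex.ofReal_add]
    have := Polynomial.eval_map_apply Complex.ofRealHom (p := physHermite n) (u + a)
    simpa using this
  rw [Polynomial.eval_mul, e, e, ← hconst, Complex.exp_add]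
  have e2 : Complex.exp (-(u:ℂ)^2) = ((Real.exp (-u^2) : ℝ) : ℂ) := by push_cast; rfl
  rw [e2]
  unfold hermiteFun
  have e3 : Real.exp (-(u+q/2)^2/2) * Real.exp (-(u-q/2)^2/2) = Real.exp (-q^2/4) * Real.exp (-u^2) := by
    rw [← Real.exp_add, ← Real.exp_add]; congr 1; ring
  simp only [← mul_assoc, ← Complex.ofReal_mul]
  congr 2
  rw [← sub_eq_add_neg u (q/2)]
  linear_combination (((2 : ℝ) ^ n * (n.factorial : ℝ) * Real.sqrt π) ^ (-(1 : ℝ) / 2)) ^ 2 * 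
    (physHermite n).eval (u + q/2) * (physHermite n).eval (u - q/2) * e3

lemma amb_integrable (n : ℕ) (p q : ℝ) : Integrable (fun u : ℝ =>
    ((hermiteFun n (u + q/2) * hermiteFun n (u - q/2) : ℝ) : ℂ) * Complex.exp (Complex.I * p * u)) := by
  simp_rw [hprod_eq]
  exact (gint_integrable p _).const_mul _

lemma lag_diag (n : ℕ) (p q : ℝ) : 
  (∑ k ∈ Finset.range (n+1), (n.choose k : ℂ) * (q + Complex.I * p) ^ (n - k) *
      ((n.descFactorial k : ℂ) * 2 ^ k * (- q + Complex.I * p) ^ (n - k))) =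
    (2:ℂ)^n * (n.factorial : ℂ) * (lag 0 n ((p^2+q^2)/2) : ℝ) := by
  unfold lag
  push_cast
  rw [Finset.mul_sum, ← Finset.sum_range_reflect]
  refine Finset.sum_congr rfl fun k hk => ?_
  have hk : k ≤ n := by have := Finset.mem_range.1 hk; omega
  have e1 : n + 1 - 1 - k = n - k := by omega
  have e2 : n - (n - k) = k := by omega
  rw [e1, e2, add_zero]
  have e3 : (-(((p:ℂ)^2+(q:ℂ)^2)/2))^k * 2^k = (q + Complex.I * p) ^ k * (- q + Complex.I * p) ^ k := by
    rw [← mul_pow, ← mul_pow]; congr 1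
    linear_combination (-p^2:ℂ) * Complex.I_sq
  have e4 : (n.factorial : ℂ) = n.descFactorial (n-k) * k.factorial := by
    have := Nat.factorial_mul_descFactorial (n := n) (k := n-k) (by omega)
    rw [e2] at this
    rw [← this]; push_cast; ring
  have e5 : (2:ℂ)^n = 2^(n-k) * 2^k := by rw [← pow_add]; congr 1; omega
  have : (k.factorial : ℂ) ≠ 0 := by exact_mod_cast k.factorial_ne_zero
  rw [e4, e5]
  field_simp
  rw [mul_comm] at e3
  linear_combination -(n.choose (n-k):ℂ) * e3

lemma amb (n : ℕ) (p q : ℝ) : ∫ u : ℝ,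
    ((hermiteFun n (u + q/2) * hermiteFun n (u - q/2) : ℝ) : ℂ) * Complex.exp (Complex.I * p * u) =
    (ell n ((p^2+q^2)/2) : ℝ) := by
  simp_rw [hprod_eq]
  rw [integral_const_mul]
  have := TT_formula p ((q/2 : ℝ):ℂ) ((-(q/2) : ℝ):ℂ) n n
  rw [gauss00] at this
  have e1 : 2 * ((q/2 : ℝ):ℂ) + Complex.I * p = q + Complex.I * p := by push_cast; ring
  have e2 : 2 * ((-(q/2) : ℝ):ℂ) + Complex.I * p = - q + Complex.I * p := by push_cast; ring
  rw [e1, e2, lag_diag] at this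
  unfold TT gint at this
  rw [this]
  have e3 : Complex.exp (-(p:ℂ)^2/4) = ((Real.exp (-p^2/4) : ℝ) : ℂ) := by push_cast; rfl
  rw [e3]
  have e4 : (2:ℂ)^n * (n.factorial : ℂ) = (((2:ℝ)^n * n.factorial : ℝ):ℂ) := by push_cast; rfl
  rw [e4]
  simp only [← Complex.ofReal_mul]
  congr 1
  unfold ell
  have e5 : Real.exp (-((p^2+q^2)/2)/2) = Real.exp (-q^2/4) * Real.exp (-p^2/4) := by
    rw [← Real.exp_add]; congr 1; ring
  rw [e5]
  have : Real.sqrt π ≠ 0 := by positivity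
  field_simp

lemma physHermite_neg (n : ℕ) : (physHermite n).comp (-Polynomial.X) = (-1)^n * physHermite n := by
  induction n with
  | zero => simp [physHermite]
  | succ n ih =>
    have h := congrArg Polynomial.derivative ih
    rw [Polynomial.derivative_comp] at h
    have h1 : Polynomial.derivative ((-1)^n * physHermite n) = (-1)^n * Polynomial.derivative (physHermite n) := by
      rw [show ((-1:Polynomial ℝ)^n) = Polynomial.C ((-1)^n) by simp, Polynomial.derivative_C_mul]
    rw [h1] at h
    simp only [Polynomial.derivative_neg, Polynomial.derivative_X] at h
    rw [physHermite_succ]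
    simp only [Polynomial.sub_comp, Polynomial.mul_comp, Polynomial.X_comp, Polynomial.ofNat_comp, ih]
    linear_combination h

lemma hermiteFun_neg (n : ℕ) (t : ℝ) : hermiteFun n (-t) = (-1)^n * hermiteFun n t := by
  have := congrArg (Polynomial.eval t) (physHermite_neg n)
  simp at this
  unfold hermiteFun
  rw [this, neg_sq]; ring

lemma hermiteFun_cont (n : ℕ) : Continuous (hermiteFun n) := by
  unfold hermiteFun
  have := (physHermite n).continuous
  fun_prop

lemma lag_bound (α n : ℕ) (y : ℝ) (hy : 0 ≤ y) : |lag α n y| ≤ 2^(n+α) * 8^n * Real.exp (y/8) := by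
  unfold lag
  calc _ ≤ ∑ j ∈ Finset.range (n+1), |((n+α).choose (n-j) : ℝ) * ((-y)^j / (j.factorial : ℝ))| :=
        Finset.abs_sum_le_sum_abs _ _
    _ ≤ ∑ j ∈ Finset.range (n+1), ((n+α).choose (n-j) : ℝ) * (8^n * Real.exp (y/8)) := by
        refine Finset.sum_le_sum fun j hj => ?_
        have hj : j ≤ n := by have := Finset.mem_range.1 hj; omega
        rw [abs_mul, Nat.abs_cast]
        gcongr
        rw [abs_div, abs_pow, abs_neg, abs_of_nonneg hy, Nat.abs_cast]
        have h1 := Real.pow_div_factorial_le_exp (y/8) (by positivity) j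
        calc y^j / (j.factorial:ℝ) = 8^j * ((y/8)^j / (j.factorial:ℝ)) := by
              rw [div_pow]; field_simp
          _ ≤ 8^n * Real.exp (y/8) := by gcongr; norm_num
    _ = (∑ j ∈ Finset.range (n+1), ((n+α).choose j : ℝ)) * (8^n * Real.exp (y/8)) := by
        rw [← Finset.sum_mul, ← Finset.sum_range_reflect]
        congr 1
        refine Finset.sum_congr rfl fun j hj => ?_
        have hj : j ≤ n := by have := Finset.mem_range.1 hj; omega
        congr 2; omega
    _ ≤ _ := by
        rw [mul_assoc]
        gcongr
        have h := Nat.sum_range_choose (n+α)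
        have h2 : ∑ j ∈ Finset.range (n+1), (n+α).choose j ≤ 2^(n+α) := by
          rw [← h]
          refine Finset.sum_le_sum_of_subset (Finset.range_mono (by omega))
        exact_mod_cast h2

lemma ell_cont (n : ℕ) : Continuous (ell n) := by
  unfold ell lag; fun_prop

lemma ell_bound (n : ℕ) (y : ℝ) (hy : 0 ≤ y) : |ell n y| ≤ 16^n * Real.exp (-(3/8)*y) := by
  unfold ell
  rw [abs_mul, Real.abs_exp]
  have h := lag_bound 0 n y hy
  calc _ ≤ (2^(n+0) * 8^n * Real.exp (y/8)) * Real.exp (-y/2) := by gcongr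
    _ = 16^n * Real.exp (-(3/8)*y) := by
      rw [add_zero, ← mul_pow, mul_assoc, ← Real.exp_add]; norm_num; ring

lemma ell_zero (n : ℕ) : ell n 0 = 1 := by
  unfold ell lag
  rw [Finset.sum_eq_single 0] <;> simp +contextual

end

section
open MeasureTheory Real Filter
open scoped BigOperators ENNReal FourierTransform

lemma sq_hermite_integrable (n : ℕ) (a : ℝ) : Integrable (fun u => hermiteFun n (u + a) ^ 2) := by
  have h := amb_integrable n 0 0
  have h2 : Integrable (fun u => hermiteFun n u ^ 2) := by
    have := h.re
    refine this.congr (ae_of_all _ fun u => ?_)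
    simp [sq]
  exact h2.comp_add_right a

lemma sq_hermite_integral (n : ℕ) (a : ℝ) : ∫ u, hermiteFun n (u + a) ^ 2 = 1 := by
  rw [integral_add_right_eq_self (fun u => hermiteFun n u ^ 2)]
  have h := amb n 0 0
  simp [ell_zero, ← sq] at h
  have h' : ((∫ u, hermiteFun n u ^ 2 : ℝ) : ℂ) = 1 := by
    rw [← integral_complex_ofReal, ← h]; simp
  exact_mod_cast h'

lemma ell_le_one (n : ℕ) (y : ℝ) (hy : 0 ≤ y) : |ell n y| ≤ 1 := by
  set q := Real.sqrt (2*y)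
  have h := amb n 0 q
  have hq : ((0:ℝ)^2 + q^2)/2 = y := by
    rw [Real.sq_sqrt (by positivity)]; ring
  rw [hq] at h
  rw [← Real.norm_eq_abs, ← Complex.norm_real, ← h]
  calc _ ≤ ∫ u, (hermiteFun n (u + q/2) ^ 2 + hermiteFun n (u + (-(q/2))) ^ 2)/2 := by
        refine norm_integral_le_of_norm_le
          (((sq_hermite_integrable n _).add (sq_hermite_integrable n _)).div_const 2)
          (ae_of_all _ fun u => ?_)
        simp only [Complex.ofReal_zero, mul_zero, zero_mul, Complex.exp_zero, mul_one,
          Complex.norm_real, Real.norm_eq_abs, sub_eq_add_neg]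
        rw [abs_le]
        constructor
        · nlinarith [sq_nonneg (hermiteFun n (u + q/2) + hermiteFun n (u + (-(q/2))))]
        · nlinarith [sq_nonneg (hermiteFun n (u + q/2) - hermiteFun n (u + (-(q/2))))]
    _ = 1 := by
        rw [integral_div, integral_add (sq_hermite_integrable n _) (sq_hermite_integrable n _),
          sq_hermite_integral, sq_hermite_integral]
        norm_num

lemma half_eq (n : ℕ) (x ξ v : ℝ) :
   ((hermiteFun n (x + (2*v)/2) * hermiteFun n (x - (2*v)/2) : ℝ) : ℂ) *
      Complex.exp (-Complex.I * ((2*v : ℝ):ℂ) * ξ) = (-1)^n * (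
    ((hermiteFun n (v + (2*x)/2) * hermiteFun n (v - (2*x)/2) : ℝ) : ℂ) *
      Complex.exp (Complex.I * ((-2*ξ:ℝ):ℂ) * v)) := by
  have e1 : hermiteFun n (x - (2*v)/2) = (-1)^n * hermiteFun n (v - (2*x)/2) := by
    rw [← hermiteFun_neg]; congr 1; ring
  rw [e1]
  have e2 : x + (2*v)/2 = v + (2*x)/2 := by ring
  rw [e2]
  have e3 : -Complex.I * ((2*v : ℝ):ℂ) * ξ = Complex.I * ((-2*ξ:ℝ):ℂ) * v := by push_cast; ring
  rw [e3]; push_cast; ring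

lemma wig1_integrable (n : ℕ) (x ξ : ℝ) : Integrable (fun v : ℝ =>
    ((hermiteFun n (x + v/2) * hermiteFun n (x - v/2) : ℝ) : ℂ) * Complex.exp (-Complex.I * v * ξ)) := by
  rw [← integrable_comp_mul_left_iff _ (two_ne_zero (α := ℝ))]
  simp_rw [half_eq]
  exact (amb_integrable n _ _).const_mul _

lemma wig1 (n : ℕ) (x ξ : ℝ) : ∫ v : ℝ,
    ((hermiteFun n (x + v/2) * hermiteFun n (x - v/2) : ℝ) : ℂ) * Complex.exp (-Complex.I * v * ξ) =
    ((2 * (-1)^n * ell n (2 * (x^2 + ξ^2)) : ℝ):ℂ) := by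
  have h := Measure.integral_comp_mul_left (fun v : ℝ =>
    ((hermiteFun n (x + v/2) * hermiteFun n (x - v/2) : ℝ) : ℂ) * Complex.exp (-Complex.I * v * ξ)) 2
  simp_rw [half_eq] at h
  rw [integral_const_mul, amb] at h
  have e : ((-2*ξ)^2 + (2*x)^2)/2 = 2*(x^2+ξ^2) := by ring
  rw [e] at h
  have h2 : |(2:ℝ)⁻¹| = 2⁻¹ := by rw [abs_of_pos]; norm_num
  rw [h2, Complex.real_smul] at h
  push_cast at h ⊢
  linear_combination -2 * h

lemma ell_integrable1 (n : ℕ) (x c : ℝ) (hc : 0 < c) :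
    Integrable (fun ξ : ℝ => ell n (c * (x^2 + ξ^2))) := by
  have h := (integrable_exp_neg_mul_sq (b := 3/8*c) (by positivity)).const_mul
    ((16:ℝ)^n * Real.exp (-(3/8*c)*x^2))
  have hc := ell_cont n
  refine h.mono' (by fun_prop) (ae_of_all _ fun ξ => ?_)
  refine (ell_bound n _ (by positivity)).trans (le_of_eq ?_)
  rw [mul_assoc, ← Real.exp_add]; congr 2; ring

lemma ell_integrable2 (n : ℕ) (c : ℝ) (hc : 0 < c) :
    Integrable (fun z : ℝ × ℝ => ell n (c * (z.1^2 + z.2^2))) := by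
  have h1 := (integrable_exp_neg_mul_sq (b := 3/8*c) (by positivity))
  have h := (h1.mul_prod h1).const_mul ((16:ℝ)^n)
  have hc := ell_cont n
  refine h.mono' (by fun_prop) (ae_of_all _ fun ξ => ?_)
  refine (ell_bound n _ (by positivity)).trans (le_of_eq ?_)
  rw [← Real.exp_add]; congr 2; ring

lemma inv1 (n : ℕ) (x q : ℝ) : ∫ ξ : ℝ,
    (((π⁻¹ * (-1)^n) * ell n (2 * (x^2 + ξ^2)) : ℝ):ℂ) * Complex.exp (Complex.I * q * ξ) =
    ((hermiteFun n (x + q/2) * hermiteFun n (x - q/2) : ℝ) : ℂ) := by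
  set f : ℝ → ℂ := fun v => ((hermiteFun n (x + v/2) * hermiteFun n (x - v/2) : ℝ) : ℂ) with hf
  have hc := hermiteFun_cont n
  have hfc : Continuous f := by fun_prop
  have hfi : Integrable f := by
    have := wig1_integrable n x 0
    simpa [hf] using this
  have hF : ∀ w, 𝓕 f w = ((2 * (-1)^n * ell n (2 * (x^2 + (2*π*w)^2)) : ℝ):ℂ) := by
    intro w
    rw [Real.fourier_real_eq_integral_exp_smul, ← wig1]
    refine integral_congr_ae (ae_of_all _ fun v => ?_)
    simp only [smul_eq_mul, hf]
    rw [mul_comm]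
    congr 2; push_cast; ring
  have hFi : Integrable (𝓕 f) := by
    have : 𝓕 f = fun w => ((2 * (-1)^n * ell n (2 * (x^2 + (2*π*w)^2)) : ℝ):ℂ) := funext hF
    rw [this]
    have h1 := (ell_integrable1 n x 2 two_pos).comp_mul_left' (R := 2*π) (by positivity)
    exact (h1.const_mul (2 * (-1)^n)).ofReal
  have h := congrFun (hfc.fourierInv_fourier_eq hfi hFi) q
  rw [Real.fourierInv_eq'] at h
  simp only [hF] at h
  have h3 := Measure.integral_comp_mul_left (fun ξ : ℝ =>
    (((π⁻¹ * (-1)^n) * ell n (2 * (x^2 + ξ^2)) : ℝ):ℂ) * Complex.exp (Complex.I * q * ξ)) (2*π)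
  rw [abs_of_pos (by positivity), Complex.real_smul] at h3
  have hp : (π:ℂ) ≠ 0 := by exact_mod_cast Real.pi_ne_zero
  have h4 : ∀ I : ℂ, I = (2*π) * (((2*π)⁻¹ : ℝ) * I) := by
    intro I; push_cast; field_simp
  rw [h4 (∫ ξ : ℝ, _), ← h3, ← integral_const_mul]
  refine Eq.trans ?_ h
  refine integral_congr_ae (ae_of_all _ fun v => ?_)
  simp only [smul_eq_mul]
  rw [mul_comm (Complex.exp _), ← mul_assoc]
  congr 1
  · push_cast; field_simp
  · congr 1; simp; ring

lemma char1 (n : ℕ) (p q : ℝ) : ∫ z : ℝ × ℝ,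
    (((π⁻¹ * (-1)^n) * ell n (2 * (z.1^2 + z.2^2)) : ℝ):ℂ) *
      Complex.exp (Complex.I * (p * z.1 + q * z.2)) =
    (ell n ((p^2+q^2)/2) : ℝ) := by
  rw [Measure.volume_eq_prod, integral_prod]
  · rw [← amb]
    refine integral_congr_ae (ae_of_all _ fun x => ?_)
    simp only
    rw [← inv1, ← integral_mul_const]
    refine integral_congr_ae (ae_of_all _ fun y => ?_)
    simp only
    rw [mul_assoc (Complex.ofReal _), ← Complex.exp_add]
    congr 2; ring
  · have h := ((ell_integrable2 n 2 two_pos).const_mul (π⁻¹ * (-1)^n)).ofReal (𝕜 := ℂ)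
    have hc := ell_cont n
    refine h.mono (by fun_prop) (ae_of_all _ fun z => ?_)
    rw [norm_mul]
    have : ‖Complex.exp (Complex.I * (p * z.1 + q * z.2))‖ = 1 := by
      rw [Complex.norm_exp]; simp
    rw [this, mul_one]; rfl

/-- scaled version -/
lemma char1h (n : ℕ) (hb : ℝ) (hhb : 0 < hb) (p q : ℝ) : ∫ z : ℝ × ℝ,
    ((((π*hb)⁻¹ * (-1)^n) * ell n (2/hb * (z.1^2 + z.2^2)) : ℝ):ℂ) *
      Complex.exp (Complex.I * (p * z.1 + q * z.2)) =
    (ell n (hb * (p^2+q^2)/2) : ℝ) := by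
  set s := Real.sqrt hb with hs
  have hs0 : 0 < s := Real.sqrt_pos.2 hhb
  have hss : s^2 = hb := Real.sq_sqrt hhb.le
  have h := Measure.integral_comp_smul (volume : Measure (ℝ × ℝ)) (fun z : ℝ × ℝ =>
    ((((π*hb)⁻¹ * (-1)^n) * ell n (2/hb * (z.1^2 + z.2^2)) : ℝ):ℂ) *
      Complex.exp (Complex.I * (p * z.1 + q * z.2))) s
  have h1 := char1 n (s*p) (s*q)
  have e : ((s*p)^2+(s*q)^2)/2 = hb * (p^2+q^2)/2 := by rw [← hss]; ring
  rw [e] at h1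
  rw [← h1]
  have hfr : Module.finrank ℝ (ℝ × ℝ) = 2 := by simp
  rw [hfr, hss, abs_of_pos (by positivity), Complex.real_smul] at h
  have hbc : (hb:ℂ) ≠ 0 := by exact_mod_cast hhb.ne'
  have h4 : ∀ I : ℂ, I = hb * (((hb)⁻¹ : ℝ) * I) := by
    intro I; push_cast; field_simp
  rw [h4 (∫ z : ℝ × ℝ, ((((π*hb)⁻¹ * (-1)^n) * ell n (2/hb * (z.1^2 + z.2^2)) : ℝ):ℂ) *
      Complex.exp (Complex.I * (p * z.1 + q * z.2))), ← h, ← integral_const_mul]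
  refine integral_congr_ae (ae_of_all _ fun z => ?_)
  simp only [Prod.smul_fst, Prod.smul_snd, smul_eq_mul]
  rw [← mul_assoc]
  have e2 : 2/hb * ((s*z.1)^2 + (s*z.2)^2) = 2 * (z.1^2+z.2^2) := by
    rw [mul_pow, mul_pow, hss]; field_simp
  rw [e2]
  congr 1
  · push_cast; field_simp
  · congr 1; push_cast; ring

end

section
open MeasureTheory Real Filter
open scoped BigOperators ENNReal FourierTransform

lemma choose_conv (N : ℕ) : ∀ (β i j : ℕ), ∑ x ∈ Finset.HasAntidiagonal.antidiagonal N,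
    x.1.choose i * (x.2 + β).choose (β + j) = (N + β + 1).choose (β + 1 + i + j) := by
  induction N with
  | zero =>
    intro β i j
    simp only [Finset.Nat.antidiagonal_zero, Finset.sum_singleton, zero_add]
    rcases i with _ | i <;> rcases j with _ | j
    · simp
    · rw [Nat.choose_eq_zero_of_lt (by omega : β < β + (j+1)),
        Nat.choose_eq_zero_of_lt (by omega : β + 1 < _)]
      simp
    · rw [Nat.choose_eq_zero_of_lt (by omega : β + 1 < _)]; simp
    · rw [Nat.choose_eq_zero_of_lt (by omega : β + 1 < _)]; simp
  | succ N ih =>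
    intro β i j
    rw [Finset.Nat.sum_antidiagonal_succ]
    rcases i with _ | i
    · have h := ih β 0 j
      simp only [Nat.choose_zero_right, one_mul, add_zero] at h ⊢
      rw [h]
      have e : N + 1 + β + 1 = (N + β + 1) + 1 := by omega
      have e2 : β + 1 + j = (β + j) + 1 := by omega
      have e3 : N + 1 + β = N + β + 1 := by omega
      rw [e, e2, e3, Nat.choose_succ_succ (N+β+1) (β+j)]
    · have h := ih β i j
      have h' := ih β (i+1) j
      simp only [Nat.choose_zero_succ, zero_mul, zero_add, Nat.choose_succ_succ, Nat.succ_eq_add_one, add_mul,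
        Finset.sum_add_distrib]
      rw [h, h']
      have e : N + 1 + β + 1 = (N + β + 1) + 1 := by omega
      have e2 : β + 1 + (i+1) + j = (β + 1 + i + j) + 1 := by omega
      rw [e, e2, Nat.choose_succ_succ (N+β+1)]

lemma lag_eq (β n M : ℕ) (h : n ≤ M) (y : ℝ) : lag β n y =
    ∑ j ∈ Finset.range (M+1), ((n+β).choose (β+j) : ℝ) * ((-y)^j / (j.factorial : ℝ)) := by
  unfold lag
  rw [← Finset.sum_subset (Finset.range_mono (by omega : n+1 ≤ M+1))]
  · refine Finset.sum_congr rfl fun j hj => ?_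
    have hj : j ≤ n := by have := Finset.mem_range.1 hj; omega
    congr 2
    rw [← Nat.choose_symm (by omega : β + j ≤ n + β)]
    congr 1; omega
  · intro j _ hj
    have hj : n < j := by by_contra hc; exact hj (Finset.mem_range.2 (by omega))
    rw [Nat.choose_eq_zero_of_lt (by omega)]; simp

lemma exp_conv (x y : ℝ) (J : ℕ) : (x+y)^J / (J.factorial:ℝ) =
    ∑ k ∈ Finset.range (J+1), (x^k / (k.factorial:ℝ)) * (y^(J-k) / ((J-k).factorial:ℝ)) := by
  rw [add_pow, Finset.sum_div]
  refine Finset.sum_congr rfl fun k hk => ?_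
  have hk : k ≤ J := by have := Finset.mem_range.1 hk; omega
  have h := Nat.choose_mul_factorial_mul_factorial hk
  have h' : (J.choose k : ℝ) * k.factorial * (J-k).factorial = J.factorial := by exact_mod_cast h
  rw [← h']
  have : (J.choose k : ℝ) ≠ 0 := by exact_mod_cast (Nat.choose_pos hk).ne'
  field_simp

lemma lag_conv (β N : ℕ) (y Y : ℝ) : ∑ x ∈ Finset.HasAntidiagonal.antidiagonal N, lag 0 x.1 y * lag β x.2 Y =
    lag (β+1) N (y+Y) := by
  set a : ℕ → ℝ := fun i => (-y)^i / (i.factorial:ℝ)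
  set b : ℕ → ℝ := fun i => (-Y)^i / (i.factorial:ℝ)
  have h1 : ∑ x ∈ Finset.HasAntidiagonal.antidiagonal N, lag 0 x.1 y * lag β x.2 Y =
      ∑ x ∈ Finset.HasAntidiagonal.antidiagonal N, ∑ i ∈ Finset.range (N+1), ∑ j ∈ Finset.range (N+1),
        ((x.1.choose i * (x.2 + β).choose (β + j) : ℕ) : ℝ) * (a i * b j) := by
    refine Finset.sum_congr rfl fun x hx => ?_
    have hx := Finset.HasAntidiagonal.mem_antidiagonal.1 hx
    rw [lag_eq 0 x.1 N (by omega), lag_eq β x.2 N (by omega), Finset.sum_mul_sum]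
    refine Finset.sum_congr rfl fun i _ => Finset.sum_congr rfl fun j _ => ?_
    simp only [a, b, add_zero, zero_add]; push_cast; ring
  rw [h1, Finset.sum_comm]
  have h2 : ∀ i ∈ Finset.range (N+1), (∑ x ∈ Finset.HasAntidiagonal.antidiagonal N, ∑ j ∈ Finset.range (N+1),
        ((x.1.choose i * (x.2 + β).choose (β + j) : ℕ) : ℝ) * (a i * b j)) =
      ∑ j ∈ Finset.range (N+1-i), ((N+β+1).choose (β+1+i+j) : ℝ) * (a i * b j) := by
    intro i hi
    rw [Finset.sum_comm]
    rw [← Finset.sum_subset (Finset.range_mono (by omega : N+1-i ≤ N+1))]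
    · refine Finset.sum_congr rfl fun j _ => ?_
      rw [← Finset.sum_mul, ← Nat.cast_sum, choose_conv]
    · intro j _ hj
      have hj : N + 1 - i ≤ j := by by_contra hc; exact hj (Finset.mem_range.2 (by omega))
      rw [← Finset.sum_mul, ← Nat.cast_sum, choose_conv, Nat.choose_eq_zero_of_lt (by omega)]
      simp
  rw [Finset.sum_congr rfl h2, ← Finset.sum_range_diag_flip, lag_eq (β+1) N N le_rfl]
  refine Finset.sum_congr rfl fun J _ => ?_
  rw [neg_add, exp_conv, Finset.mul_sum]
  refine Finset.sum_congr rfl fun k hk => ?_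
  have hk : k ≤ J := by have := Finset.mem_range.1 hk; omega
  have e : β + 1 + k + (J - k) = β + 1 + J := by omega
  rw [e, ← add_assoc]

lemma wig1h_eq (n : ℕ) (hb : ℝ) (hhb : 0 < hb) (x ξ v : ℝ) : 
    ((hb ^ (-(1:ℝ)/2) * (hermiteFun n (hb ^ (-(1:ℝ)/2) * (x + v/2)) *
      hermiteFun n (hb ^ (-(1:ℝ)/2) * (x - v/2))) : ℝ) : ℂ)
      * Complex.exp (-Complex.I * (v * ξ : ℝ) / hb) =
    ((hb ^ (-(1:ℝ)/2) : ℝ) : ℂ) * (fun w : ℝ => 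
     ((hermiteFun n ((hb ^ (-(1:ℝ)/2) * x) + w/2) * hermiteFun n ((hb ^ (-(1:ℝ)/2) * x) - w/2) : ℝ) : ℂ)
      * Complex.exp (-Complex.I * w * ((hb ^ (-(1:ℝ)/2) * ξ : ℝ):ℂ))) ((hb ^ (-(1:ℝ)/2)) * v) := by
  have hc : (hb ^ (-(1:ℝ)/2)) * (hb ^ (-(1:ℝ)/2)) = hb⁻¹ := by
    rw [← Real.rpow_add hhb]; norm_num; rw [Real.rpow_neg_one]
  set c := hb ^ (-(1:ℝ)/2)
  simp only
  have e1 : c * (x + v/2) = c * x + (c*v)/2 := by ring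
  have e2 : c * (x - v/2) = c * x - (c*v)/2 := by ring
  have e3 : -Complex.I * (v * ξ : ℝ) / hb = -Complex.I * ((c * v : ℝ):ℂ) * ((c * ξ : ℝ):ℂ) := by
    rw [div_eq_mul_inv, ← Complex.ofReal_inv, ← hc]; push_cast; ring
  rw [e1, e2, e3]; push_cast; ring

lemma wig1h_integrable (n : ℕ) (hb : ℝ) (hhb : 0 < hb) (x ξ : ℝ) : Integrable fun v : ℝ =>
    ((hb ^ (-(1:ℝ)/2) * (hermiteFun n (hb ^ (-(1:ℝ)/2) * (x + v/2)) *
      hermiteFun n (hb ^ (-(1:ℝ)/2) * (x - v/2))) : ℝ) : ℂ)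
      * Complex.exp (-Complex.I * (v * ξ : ℝ) / hb) := by
  simp_rw [wig1h_eq n hb hhb]
  exact ((wig1_integrable n _ _).comp_mul_left' (by positivity)).const_mul _

lemma wig1h (n : ℕ) (hb : ℝ) (hhb : 0 < hb) (x ξ : ℝ) : ∫ v : ℝ,
    ((hb ^ (-(1:ℝ)/2) * (hermiteFun n (hb ^ (-(1:ℝ)/2) * (x + v/2)) *
      hermiteFun n (hb ^ (-(1:ℝ)/2) * (x - v/2))) : ℝ) : ℂ)
      * Complex.exp (-Complex.I * (v * ξ : ℝ) / hb) =
    ((2 * (-1)^n * ell n (2/hb * (x^2 + ξ^2)) : ℝ):ℂ) := by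
  simp_rw [wig1h_eq n hb hhb]
  rw [integral_const_mul, Measure.integral_comp_mul_left (fun w : ℝ => 
     ((hermiteFun n ((hb ^ (-(1:ℝ)/2) * x) + w/2) * hermiteFun n ((hb ^ (-(1:ℝ)/2) * x) - w/2) : ℝ) : ℂ)
      * Complex.exp (-Complex.I * w * ((hb ^ (-(1:ℝ)/2) * ξ : ℝ):ℂ))), wig1]
  have hc : (hb ^ (-(1:ℝ)/2)) * (hb ^ (-(1:ℝ)/2)) = hb⁻¹ := by
    rw [← Real.rpow_add hhb]; norm_num; rw [Real.rpow_neg_one]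
  have hcp : 0 < hb ^ (-(1:ℝ)/2) := by positivity
  set c := hb ^ (-(1:ℝ)/2)
  have e : 2 * ((c*x)^2 + (c*ξ)^2) = 2/hb * (x^2+ξ^2) := by
    rw [div_eq_mul_inv, ← hc]; ring
  rw [e, abs_of_pos (by positivity), Complex.real_smul, ← mul_assoc, ← Complex.ofReal_mul,
    mul_inv_cancel₀ hcp.ne', Complex.ofReal_one, one_mul]

lemma wigner_eq (d : ℕ) (hb : ℝ) (hhb : 0 < hb) (N : ℕ) (x ξ : Fin d → ℝ) :
    wigner d hb N x ξ = ∑ α ∈ Finset.Nat.antidiagonalTuple d N, ∏ j,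
      ((((π*hb)⁻¹ * (-1)^(α j)) * ell (α j) (2/hb * (x j^2 + ξ j^2)) : ℝ) : ℂ) := by
  unfold wigner
  have h1 : ∀ v : Fin d → ℝ, 
      ((projKer d hb N (fun j => x j + v j / 2) (fun j => x j - v j / 2) : ℝ) : ℂ) *
        Complex.exp (-Complex.I * (dotR v ξ : ℂ) / (hb : ℂ)) =
      ∑ α ∈ Finset.Nat.antidiagonalTuple d N, ∏ j, 
       (((hb ^ (-(1:ℝ)/2) * (hermiteFun (α j) (hb ^ (-(1:ℝ)/2) * (x j + v j/2)) *
      hermiteFun (α j) (hb ^ (-(1:ℝ)/2) * (x j - v j/2))) : ℝ) : ℂ)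
      * Complex.exp (-Complex.I * (v j * ξ j : ℝ) / hb)) := by
    intro v
    unfold projKer
    rw [Complex.ofReal_sum, Finset.sum_mul]
    refine Finset.sum_congr rfl fun α _ => ?_
    rw [Finset.prod_mul_distrib, ← Complex.exp_sum, ← Complex.ofReal_prod]
    congr 2
    · unfold hermiteProdH hermiteProd
      rw [Finset.prod_mul_distrib, Finset.prod_mul_distrib]
      have : (∏ i : Fin d, hb ^ (-(1:ℝ)/2)) = hb ^ (-(d:ℝ)/4) * hb ^ (-(d:ℝ)/4) := by
        rw [Finset.prod_const, ← Real.rpow_natCast, ← Real.rpow_mul hhb.le, ← Real.rpow_add hhb]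
        congr 1; simp; ring
      rw [this]; ring
    · unfold dotR
      rw [← Finset.sum_div, ← Finset.mul_sum]; push_cast; rfl
  simp_rw [h1]
  rw [integral_finsetSum, Finset.mul_sum]
  · refine Finset.sum_congr rfl fun α _ => ?_
    rw [integral_fintype_prod_volume_eq_prod (fun j (w:ℝ) => 
     (((hb ^ (-(1:ℝ)/2) * (hermiteFun (α j) (hb ^ (-(1:ℝ)/2) * (x j + w/2)) *
      hermiteFun (α j) (hb ^ (-(1:ℝ)/2) * (x j - w/2))) : ℝ) : ℂ)
      * Complex.exp (-Complex.I * (w * ξ j : ℝ) / hb)))]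
    simp_rw [wig1h _ hb hhb]
    have : ((((2 * π * hb) ^ d)⁻¹ : ℝ) : ℂ) = ∏ j : Fin d, (((2*π*hb)⁻¹ : ℝ):ℂ) := by
      rw [Finset.prod_const, Finset.card_univ, Fintype.card_fin, ← inv_pow, Complex.ofReal_pow]
    rw [this, ← Finset.prod_mul_distrib]
    refine Finset.prod_congr rfl fun j _ => ?_
    rw [← Complex.ofReal_mul]
    congr 1
    field_simp
  · intro α _
    exact Integrable.fintype_prod (f := fun j (w:ℝ) => 
     (((hb ^ (-(1:ℝ)/2) * (hermiteFun (α j) (hb ^ (-(1:ℝ)/2) * (x j + w/2)) *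
      hermiteFun (α j) (hb ^ (-(1:ℝ)/2) * (x j - w/2))) : ℝ) : ℂ)
      * Complex.exp (-Complex.I * (w * ξ j : ℝ) / hb))) (fun j => wig1h_integrable _ hb hhb _ _)

end

section
open MeasureTheory Real Filter
open scoped BigOperators ENNReal FourierTransform

lemma sum_tuple_succ (k N : ℕ) (F : (Fin (k+1) → ℕ) → ℝ) :
    ∑ α ∈ Finset.Nat.antidiagonalTuple (k+1) N, F α =
    ∑ x ∈ Finset.HasAntidiagonal.antidiagonal N, ∑ β ∈ Finset.Nat.antidiagonalTuple k x.2,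
      F (Fin.cons x.1 β) := by
  rw [Finset.sum_sigma']
  refine Finset.sum_bij' (fun α _ => ⟨(α 0, ∑ i : Fin k, α i.succ), Fin.tail α⟩)
    (fun z _ => Fin.cons z.1.1 z.2) ?_ ?_ ?_ ?_ ?_
  · intro α hα
    rw [Finset.Nat.mem_antidiagonalTuple, Fin.sum_univ_succ] at hα
    simp only [Finset.mem_sigma, Finset.HasAntidiagonal.mem_antidiagonal, Finset.Nat.mem_antidiagonalTuple]
    exact ⟨hα, rfl⟩
  · rintro ⟨⟨a, b⟩, β⟩ hz
    simp only [Finset.mem_sigma, Finset.HasAntidiagonal.mem_antidiagonal, Finset.Nat.mem_antidiagonalTuple] at hz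
    rw [Finset.Nat.mem_antidiagonalTuple, Fin.sum_univ_succ]
    simp [hz.1, hz.2]
  · intro α _
    simp
  · rintro ⟨⟨a, b⟩, β⟩ hz
    simp only [Finset.mem_sigma, Finset.HasAntidiagonal.mem_antidiagonal, Finset.Nat.mem_antidiagonalTuple] at hz
    simp [hz.2]
  · intro α _
    simp

lemma sum_lag (d : ℕ) : ∀ (N : ℕ) (y : Fin (d+1) → ℝ),
    ∑ α ∈ Finset.Nat.antidiagonalTuple (d+1) N, ∏ j, lag 0 (α j) (y j) = lag d N (∑ j, y j) := by
  induction d with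
  | zero =>
    intro N y
    simp [Finset.Nat.antidiagonalTuple_one]
  | succ d ih =>
    intro N y
    rw [sum_tuple_succ]
    simp_rw [Fin.prod_univ_succ (n := d+1), Fin.cons_zero, Fin.cons_succ, ← Finset.mul_sum, ih]
    rw [lag_conv, Fin.sum_univ_succ (n := d+1)]

/-- multi-dimensional ell -/
def EL (d N : ℕ) (y : ℝ) : ℝ := lag (d-1) N y * Real.exp (-y/2)

lemma sum_ell (d : ℕ) (hd : 1 ≤ d) (N : ℕ) (y : Fin d → ℝ) :
    ∑ α ∈ Finset.Nat.antidiagonalTuple d N, ∏ j, ell (α j) (y j) = EL d N (∑ j, y j) := by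
  obtain ⟨d, rfl⟩ : ∃ e, d = e + 1 := ⟨d-1, by omega⟩
  unfold ell EL
  simp_rw [Finset.prod_mul_distrib, ← Finset.sum_mul]
  rw [sum_lag, ← Real.exp_sum, ← Finset.sum_div, Finset.sum_neg_distrib]
  rfl

lemma EL_zero (d N : ℕ) (hd : 1 ≤ d) : EL d N 0 = ((N + d - 1).choose (d-1) : ℝ) := by
  unfold EL lag
  rw [Finset.sum_eq_single 0]
  · have : N + d - 1 = N + (d-1) := by omega
    simp only [neg_zero, pow_zero, Nat.factorial_zero, Nat.cast_one, div_one, mul_one, zero_div, Real.exp_zero,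
      Nat.sub_zero]
    rw [this, Nat.choose_symm_add]
  · simp +contextual
  · simp

lemma card_tuple (d N : ℕ) (hd : 1 ≤ d) :
    ((Finset.Nat.antidiagonalTuple d N).card : ℝ) = ((N + d - 1).choose (d-1) : ℝ) := by
  have := sum_ell d hd N (fun _ => 0)
  simp only [ell_zero, Finset.prod_const_one, Finset.sum_const, nsmul_eq_mul, mul_one,
    mul_zero] at this
  rw [this, EL_zero d N hd]

lemma EL_le (d N : ℕ) (hd : 1 ≤ d) (y : ℝ) (hy : 0 ≤ y) :
    |EL d N y| ≤ ((N + d - 1).choose (d-1) : ℝ) := by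
  have h := sum_ell d hd N (fun _ => y / d)
  have hd' : (d:ℝ) ≠ 0 := by positivity
  have e : ∑ j : Fin d, y / d = y := by simp; field_simp
  rw [e] at h
  rw [← h, ← card_tuple d N hd]
  refine (Finset.abs_sum_le_sum_abs _ _).trans ?_
  have : ∀ α ∈ Finset.Nat.antidiagonalTuple d N, |∏ j, ell (α j) (y/d)| ≤ 1 := by
    intro α _
    rw [Finset.abs_prod]
    exact Finset.prod_le_one (fun _ _ => abs_nonneg _) (fun j _ => ell_le_one _ _ (by positivity))
  refine (Finset.sum_le_sum this).trans ?_
  simp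

lemma wigner_EL (d : ℕ) (hd : 1 ≤ d) (hb : ℝ) (hhb : 0 < hb) (N : ℕ) (x ξ : Fin d → ℝ) :
    wigner d hb N x ξ = ((((π*hb)⁻¹)^d * (-1)^N *
      EL d N (2/hb * ((∑ j, x j^2) + ∑ j, ξ j^2)) : ℝ) : ℂ) := by
  rw [wigner_eq d hb hhb, ← Finset.sum_add_distrib, Finset.mul_sum, ← sum_ell d hd, Finset.mul_sum]
  push_cast
  refine Finset.sum_congr rfl fun α hα => ?_
  rw [Finset.Nat.mem_antidiagonalTuple] at hα
  rw [Finset.prod_mul_distrib, Finset.prod_mul_distrib, Finset.prod_pow_eq_pow_sum, hα]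
  simp

lemma gauss_phase (d : ℕ) (c : ℝ) (hc : 0 < c) :
    Integrable (fun p : (Fin d → ℝ) × (Fin d → ℝ) =>
      Real.exp (-c * ((∑ j, p.1 j^2) + ∑ j, p.2 j^2))) ∧
    ∫ p : (Fin d → ℝ) × (Fin d → ℝ), Real.exp (-c * ((∑ j, p.1 j^2) + ∑ j, p.2 j^2)) = (π/c)^d := by
  have h1 : Integrable (fun x : Fin d → ℝ => ∏ j, Real.exp (-c * x j^2)) :=
    Integrable.fintype_prod (f := fun _ (t:ℝ) => Real.exp (-c * t^2))
      (fun _ => integrable_exp_neg_mul_sq hc)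
  have h2 : ∫ x : Fin d → ℝ, ∏ j, Real.exp (-c * x j^2) = (Real.sqrt (π/c))^d := by
    rw [integral_fintype_prod_volume_eq_prod (fun _ (t:ℝ) => Real.exp (-c * t^2))]
    simp_rw [integral_gaussian]
    simp
  have e : (fun p : (Fin d → ℝ) × (Fin d → ℝ) =>
      Real.exp (-c * ((∑ j, p.1 j^2) + ∑ j, p.2 j^2))) =
      fun p => (∏ j, Real.exp (-c * p.1 j^2)) * (∏ j, Real.exp (-c * p.2 j^2)) := by
    ext p
    rw [← Real.exp_sum, ← Real.exp_sum, ← Real.exp_add, ← Finset.mul_sum, ← Finset.mul_sum]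
    congr 1; ring
  rw [e]
  refine ⟨h1.mul_prod h1, ?_⟩
  rw [Measure.volume_eq_prod, integral_prod_mul (fun x : Fin d → ℝ => ∏ j, Real.exp (-c * x j^2))
    (fun x : Fin d → ℝ => ∏ j, Real.exp (-c * x j^2)), h2, ← mul_pow, Real.mul_self_sqrt (by positivity)]

lemma EL_bound (d N : ℕ) (y : ℝ) (hy : 0 ≤ y) :
    |EL d N y| ≤ 2^(d-1) * 16^N * Real.exp (-(3/8)*y) := by
  unfold EL
  rw [abs_mul, Real.abs_exp]
  have h := lag_bound (d-1) N y hy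
  calc _ ≤ (2^(N+(d-1)) * 8^N * Real.exp (y/8)) * Real.exp (-y/2) := by gcongr
    _ = 2^(d-1) * 16^N * Real.exp (-(3/8)*y) := by
      rw [pow_add, mul_comm ((2:ℝ)^N), mul_assoc, mul_assoc, mul_assoc, ← mul_assoc ((2:ℝ)^N), ← mul_pow,
        mul_assoc, ← Real.exp_add]
      norm_num
      ring

lemma wigner_bound (d : ℕ) (hd : 1 ≤ d) (hb : ℝ) (hhb : 0 < hb) (N : ℕ) (x ξ : Fin d → ℝ) :
    ‖wigner d hb N x ξ‖ ≤ ((π*hb)⁻¹)^d * (2^(d-1) * 16^N *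
      Real.exp (-(3/(4*hb)) * ((∑ j, x j^2) + ∑ j, ξ j^2))) := by
  rw [wigner_EL d hd hb hhb, Complex.norm_real, Real.norm_eq_abs, abs_mul, abs_mul, abs_pow, abs_pow, abs_neg,
    abs_one, one_pow, mul_one, abs_of_pos (by positivity)]
  have hnn : 0 ≤ (∑ j, x j^2) + ∑ j, ξ j^2 := by positivity
  gcongr
  refine (EL_bound d N _ (by positivity)).trans (le_of_eq ?_)
  congr 2
  field_simp
  ring

lemma EL_cont (d N : ℕ) : Continuous (EL d N) := by
  unfold EL lag; fun_prop

lemma wigner_cont (d : ℕ) (hd : 1 ≤ d) (hb : ℝ) (hhb : 0 < hb) (N : ℕ) :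
    Continuous (fun p : (Fin d → ℝ) × (Fin d → ℝ) => wigner d hb N p.1 p.2) := by
  simp_rw [wigner_EL d hd hb hhb]
  have := EL_cont d N
  fun_prop

lemma wigner_integrable (d : ℕ) (hd : 1 ≤ d) (hb : ℝ) (hhb : 0 < hb) (N : ℕ) :
    Integrable (fun p : (Fin d → ℝ) × (Fin d → ℝ) => wigner d hb N p.1 p.2) := by
  refine Integrable.mono' ((((gauss_phase d (3/(4*hb)) (by positivity)).1).const_mul
    (2^(d-1) * 16^N)).const_mul (((π*hb)⁻¹)^d))
    (wigner_cont d hd hb hhb N).aestronglyMeasurable (ae_of_all _ fun p => ?_)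
  exact wigner_bound d hd hb hhb N p.1 p.2

lemma wigner_char (d : ℕ) (hd : 1 ≤ d) (hb : ℝ) (hhb : 0 < hb) (N : ℕ) (P Q : Fin d → ℝ) :
    ∫ p : (Fin d → ℝ) × (Fin d → ℝ), wigner d hb N p.1 p.2 *
      Complex.exp (Complex.I * ((∑ j, (P j * p.1 j + Q j * p.2 j) : ℝ):ℂ)) =
    ((EL d N (hb/2 * ((∑ j, P j^2) + ∑ j, Q j^2)) : ℝ) : ℂ) := by
  rw [← (volume_measurePreserving_arrowProdEquivProdArrow ℝ ℝ (Fin d)).integral_comp']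
  have e : ∀ z : Fin d → ℝ × ℝ, (fun p : (Fin d → ℝ) × (Fin d → ℝ) => wigner d hb N p.1 p.2 *
      Complex.exp (Complex.I * ((∑ j, (P j * p.1 j + Q j * p.2 j) : ℝ):ℂ)))
        (MeasurableEquiv.arrowProdEquivProdArrow ℝ ℝ (Fin d) z) =
      ∑ α ∈ Finset.Nat.antidiagonalTuple d N, ∏ j,
      (((((π*hb)⁻¹ * (-1)^(α j)) * ell (α j) (2/hb * ((z j).1^2 + (z j).2^2)) : ℝ) : ℂ) *
      Complex.exp (Complex.I * (P j * (z j).1 + Q j * (z j).2))) := by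
    intro z
    simp only
    rw [wigner_eq d hb hhb, Finset.sum_mul]
    refine Finset.sum_congr rfl fun α _ => ?_
    rw [Finset.prod_mul_distrib, ← Complex.exp_sum, ← Finset.mul_sum]
    congr 3
    push_cast; rfl
  simp_rw [e]
  rw [integral_finsetSum]
  · rw [← Finset.sum_add_distrib, Finset.mul_sum, ← sum_ell d hd, Complex.ofReal_sum]
    refine Finset.sum_congr rfl fun α _ => ?_
    rw [integral_fintype_prod_volume_eq_prod (fun j (z : ℝ × ℝ) =>
       (((((π*hb)⁻¹ * (-1)^(α j)) * ell (α j) (2/hb * (z.1^2 + z.2^2)) : ℝ) : ℂ) *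
      Complex.exp (Complex.I * (P j * z.1 + Q j * z.2))))]
    simp_rw [char1h _ hb hhb]
    rw [Complex.ofReal_prod]
    refine Finset.prod_congr rfl fun j _ => ?_
    congr 2; ring
  · intro α _
    refine Integrable.fintype_prod (f := fun j (z : ℝ × ℝ) =>
       (((((π*hb)⁻¹ * (-1)^(α j)) * ell (α j) (2/hb * (z.1^2 + z.2^2)) : ℝ) : ℂ) *
      Complex.exp (Complex.I * (P j * z.1 + Q j * z.2)))) (fun j => ?_)
    have h := ((ell_integrable2 (α j) (2/hb) (by positivity)).const_mul ((π*hb)⁻¹ * (-1)^(α j))).ofReal (𝕜 := ℂ)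
    have hc := ell_cont (α j)
    refine h.mono (by fun_prop) (ae_of_all _ fun z => ?_)
    rw [norm_mul]
    have : ‖Complex.exp (Complex.I * (P j * z.1 + Q j * z.2))‖ = 1 := by
      rw [Complex.norm_exp]; simp
    rw [this, mul_one]; rfl

end

section
open MeasureTheory Real Filter
open scoped BigOperators ENNReal FourierTransform

/-- limiting characteristic function -/
def Psi (d : ℕ) (t : ℝ) : ℝ :=
  ∑' j : ℕ, ((d-1).factorial : ℝ) / ((d-1+j).factorial : ℝ) * ((-t)^j / (j.factorial : ℝ))

lemma choose_ratio (N β j : ℕ) :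
    ((N+β).choose (β+j) : ℝ) = ((N+β).choose β : ℝ) *
      ((N.descFactorial j : ℝ) * ((β.factorial : ℝ) / ((β+j).factorial : ℝ))) := by
  have h : (N+β).descFactorial (β+j) = (N+β).descFactorial β * N.descFactorial j := by
    induction j with
    | zero => simp
    | succ j ih =>
      rw [← add_assoc, Nat.descFactorial_succ, ih, Nat.descFactorial_succ]
      have : N + β - (β + j) = N - j := by omega
      rw [this]; ring
  rw [Nat.descFactorial_eq_factorial_mul_choose, Nat.descFactorial_eq_factorial_mul_choose (N+β) β] at h
  have h' : ((β+j).factorial : ℝ) * ((N+β).choose (β+j) : ℝ) =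
    (β.factorial : ℝ) * ((N+β).choose β : ℝ) * (N.descFactorial j : ℝ) := by exact_mod_cast h
  have := Nat.factorial_pos (β+j)
  field_simp
  linarith

lemma hPl_pos (d : ℕ) (hd : 1 ≤ d) (E : ℝ) (hE : 0 < E) (N : ℕ) : 0 < hPl d E N := by
  unfold hPl; positivity

lemma hPl_tendsto (d : ℕ) (E : ℝ) : Tendsto (hPl d E) atTop (nhds 0) := by
  unfold hPl
  exact Tendsto.const_div_atTop (tendsto_atTop_add_const_right _ _ tendsto_natCast_atTop_atTop) _

lemma hPl_mul (d : ℕ) (hd : 1 ≤ d) (E : ℝ) (N : ℕ) : (N:ℝ) * hPl d E N = E - d/2 * hPl d E N := by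
  unfold hPl
  have : (N:ℝ) + d/2 ≠ 0 := by positivity
  field_simp
  ring

lemma desc_tendsto (d : ℕ) (hd : 1 ≤ d) (E : ℝ) (j : ℕ) :
    Tendsto (fun N : ℕ => (N.descFactorial j : ℝ) * (hPl d E N)^j) atTop (nhds (E^j)) := by
  induction j with
  | zero => simp
  | succ j ih =>
    have h1 : Tendsto (fun N : ℕ => ((N - j : ℕ):ℝ) * hPl d E N) atTop (nhds E) := by
      have h2 : Tendsto (fun N : ℕ => E - (d/2 + j) * hPl d E N) atTop (nhds (E - (d/2+j)*0)) :=
        tendsto_const_nhds.sub ((hPl_tendsto d E).const_mul _)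
      rw [mul_zero, sub_zero] at h2
      refine h2.congr' ?_
      filter_upwards [eventually_ge_atTop j] with N hN
      rw [Nat.cast_sub hN, sub_mul, hPl_mul d hd]
      ring
    have := h1.mul ih
    rw [pow_succ']
    refine this.congr fun N => ?_
    rw [Nat.descFactorial_succ]
    push_cast
    ring

lemma EL_tendsto (d : ℕ) (hd : 1 ≤ d) (E : ℝ) (hE : 0 < E) (s : ℝ) (hs : 0 ≤ s) :
    Tendsto (fun N : ℕ => ((N + d - 1).choose (d-1) : ℝ)⁻¹ * EL d N (hPl d E N * s)) atTop
      (nhds (Psi d (E * s))) := by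
  have key : ∀ N : ℕ, ((N + d - 1).choose (d-1) : ℝ)⁻¹ * EL d N (hPl d E N * s) =
      (∑' j : ℕ, (N.descFactorial j : ℝ) * (hPl d E N)^j *
        (((d-1).factorial : ℝ) / ((d-1+j).factorial : ℝ) * ((-s)^j / (j.factorial : ℝ)))) *
        Real.exp (-(hPl d E N * s)/2) := by
    intro N
    have e : N + d - 1 = N + (d-1) := by omega
    have hc : ((N + (d-1)).choose (d-1) : ℝ) ≠ 0 := by
      exact_mod_cast (Nat.choose_pos (by omega)).ne'
    rw [e]
    unfold EL
    rw [lag_eq (d-1) N N le_rfl, ← mul_assoc, Finset.mul_sum]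
    congr 1
    rw [tsum_eq_sum (s := Finset.range (N+1))]
    · refine Finset.sum_congr rfl fun j _ => ?_
      rw [choose_ratio, neg_mul_eq_mul_neg, mul_pow]
      field_simp
    · intro j hj
      rw [Finset.mem_range, not_lt] at hj
      rw [Nat.descFactorial_of_lt (by omega)]
      simp
  simp_rw [key]
  have h1 : Tendsto (fun N => Real.exp (-(hPl d E N * s)/2)) atTop (nhds 1) := by
    have : Tendsto (fun N => -(hPl d E N * s)/2) atTop (nhds (-(0*s)/2)) :=
      (((hPl_tendsto d E).mul_const s).neg).div_const 2
    simpa [Function.comp_def] using (Real.continuous_exp.tendsto _).comp this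
  rw [← mul_one (Psi d (E*s))]
  refine Tendsto.mul ?_ h1
  unfold Psi
  refine tendsto_tsum_of_dominated_convergence (bound := fun j : ℕ => (E*s)^j / (j.factorial:ℝ))
    (Real.summable_pow_div_factorial _) ?_ ?_
  · intro j
    have := (desc_tendsto d hd E j).mul_const
      (((d-1).factorial : ℝ) / ((d-1+j).factorial : ℝ) * ((-s)^j / (j.factorial : ℝ)))
    convert this using 2
    rw [neg_mul_eq_mul_neg, mul_pow]
    ring
  · refine Eventually.of_forall fun N j => ?_
    have hp := hPl_pos d hd E hE N
    rw [norm_mul, norm_mul _ ((-s)^j / (j.factorial:ℝ)), norm_div (((-s)^j)), norm_pow (-s), norm_neg]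
    simp only [Real.norm_eq_abs, abs_of_nonneg hs, Nat.abs_cast]
    rw [abs_of_nonneg (by positivity), abs_of_nonneg (by positivity)]
    have a1 : (N.descFactorial j : ℝ) * (hPl d E N)^j ≤ E^j := by
      calc (N.descFactorial j : ℝ) * (hPl d E N)^j ≤ (N:ℝ)^j * (hPl d E N)^j := by
            gcongr; exact_mod_cast Nat.descFactorial_le_pow N j
        _ = ((N:ℝ) * hPl d E N)^j := by rw [mul_pow]
        _ ≤ E^j := by
            gcongr
            rw [hPl_mul d hd]
            have : 0 ≤ (d:ℝ)/2 * hPl d E N := by positivity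
            linarith
    have a2 : ((d-1).factorial : ℝ) / ((d-1+j).factorial : ℝ) ≤ 1 := by
      rw [div_le_one (by positivity)]
      exact_mod_cast Nat.factorial_le (by omega)
    calc _ ≤ E^j * (1 * (s^j / (j.factorial:ℝ))) := by gcongr
      _ = _ := by rw [mul_pow]; ring

end

section
open MeasureTheory Real Filter
open scoped BigOperators ENNReal FourierTransform

/-- graph parametrization -/
def gr (n : ℕ) (i : Fin n) (c E : ℝ) (y : {j : Fin n // j ≠ i} → ℝ) : EuclideanSpace ℝ (Fin n) :=
  WithLp.toLp 2 (fun j => if h : j = i then c * Real.sqrt (2*E - ∑ k, y k^2) else y ⟨j, h⟩)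

/-- coordinate projection -/
def prj (n : ℕ) (i : Fin n) (q : EuclideanSpace ℝ (Fin n)) : {j : Fin n // j ≠ i} → ℝ :=
  fun k => q k

lemma sum_split (n : ℕ) (i : Fin n) (F : Fin n → ℝ) :
    ∑ j, F j = F i + ∑ k : {j : Fin n // j ≠ i}, F k := by
  rw [← Finset.add_sum_erase _ _ (Finset.mem_univ i)]
  congr 1
  exact Finset.sum_subtype _ (by simp) _

lemma card_ne' (d : ℕ) (hd : 1 ≤ d) (i : Fin (d+d)) :
    (Fintype.card {j : Fin (d+d) // j ≠ i} : ℝ) = 2 * (d:ℝ) - 1 := by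
  have : Fintype.card {j : Fin (d+d) // j ≠ i} = d + d - 1 := by simp
  rw [this, Nat.cast_sub (by omega)]
  push_cast; ring

lemma hm_eq (d : ℕ) (hd : 1 ≤ d) (i : Fin (d+d)) :
    (μH[2 * (d:ℝ) - 1] : Measure ({j : Fin (d+d) // j ≠ i} → ℝ)) = volume := by
  rw [← card_ne' d hd i, hausdorffMeasure_pi_real]

lemma prj_lip (n : ℕ) (i : Fin n) : LipschitzWith 1 (prj n i) := by
  refine LipschitzWith.of_dist_le_mul fun x y => ?_
  rw [NNReal.coe_one, one_mul, dist_pi_le_iff dist_nonneg]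
  intro k
  rw [dist_eq_norm, dist_eq_norm]
  exact PiLp.norm_apply_le (x - y) _

lemma gr_mem (d : ℕ) (i : Fin (d+d)) (c E : ℝ) (hc : c^2 = 1) (y : {j : Fin (d+d) // j ≠ i} → ℝ)
    (hy : ∑ k, y k^2 ≤ 2*E) : gr (d+d) i c E y ∈ energySurf d E := by
  unfold energySurf
  rw [Set.mem_setOf_eq, sum_split _ i]
  have e : ∀ k : {j : Fin (d+d) // j ≠ i}, gr (d+d) i c E y k = y k := by
    intro k
    simp [gr, k.2]
  simp_rw [e]
  simp only [gr, dite_true]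
  rw [mul_pow, Real.sq_sqrt (by linarith), hc]
  ring

lemma surf_pos (d : ℕ) (hd : 1 ≤ d) (E : ℝ) (hE : 0 < E) :
    0 < μH[2 * (d:ℝ) - 1] (energySurf d E) := by
  have hn : 0 < d + d := by omega
  let i : Fin (d+d) := ⟨0, hn⟩
  have h1 := (prj_lip (d+d) i).hausdorffMeasure_image_le (d := 2*(d:ℝ)-1)
    (by have : (1:ℝ) ≤ d := by exact_mod_cast hd
        linarith) (energySurf d E)
  rw [hm_eq d hd i] at h1
  simp only [ENNReal.coe_one, ENNReal.one_rpow, one_mul] at h1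
  refine lt_of_lt_of_le ?_ h1
  have ho : IsOpen {y : {j : Fin (d+d) // j ≠ i} → ℝ | ∑ k, y k^2 < 2*E} :=
    isOpen_lt (by fun_prop) (by fun_prop)
  refine (ho.measure_pos volume ⟨0, by simpa using hE⟩).trans_le (measure_mono ?_)
  intro y hy
  refine ⟨gr (d+d) i 1 E y, gr_mem d i 1 E (by norm_num) y (le_of_lt hy), ?_⟩
  ext k
  simp [prj, gr, k.2]

lemma surf_closed (d : ℕ) (E : ℝ) : IsClosed (energySurf d E) :=
  isClosed_eq (by fun_prop) (by fun_prop)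

lemma surf_norm (d : ℕ) (E : ℝ) (q : EuclideanSpace ℝ (Fin (d+d))) :
    q ∈ energySurf d E ↔ ‖q‖^2 = 2*E := by
  rw [EuclideanSpace.real_norm_sq_eq]; rfl

lemma surf_compact (d : ℕ) (E : ℝ) : IsCompact (energySurf d E) := by
  refine (isCompact_closedBall (0 : EuclideanSpace ℝ (Fin (d+d))) (Real.sqrt (2*E))).of_isClosed_subset
    (surf_closed d E) ?_
  intro q hq
  rw [surf_norm] at hq
  rw [mem_closedBall_zero_iff, ← hq, Real.sqrt_sq (norm_nonneg _)]

lemma surf_finite (d : ℕ) (hd : 1 ≤ d) (E : ℝ) (hE : 0 < E) :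
    μH[2 * (d:ℝ) - 1] (energySurf d E) < ⊤ := by
  refine (surf_compact d E).measure_lt_top_of_nhdsWithin fun q hq => ?_
  have hq' : ∑ i, q i^2 = 2*E := hq
  obtain ⟨i, hi⟩ : ∃ i, q i ≠ 0 := by
    by_contra! h
    simp [h] at hq'
    linarith
  have hq2 := hq'
  rw [sum_split _ i] at hq2
  have hpos : 0 < 2*E - ∑ k, prj (d+d) i q k^2 := by
    have : 0 < q i^2 := by positivity
    unfold prj
    linarith
  let c : ℝ := SignType.sign (q i)
  have hcd : ContDiffAt ℝ 1 (gr (d+d) i c E) (prj (d+d) i q) := by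
    rw [contDiffAt_euclidean]
    intro j
    by_cases h : j = i
    · simp only [gr, h, dite_true]
      refine contDiffAt_const.mul (ContDiffAt.sqrt ?_ hpos.ne')
      fun_prop
    · simp only [gr, h, dite_false]
      fun_prop
  obtain ⟨K, t, ht, hK⟩ := hcd.exists_lipschitzOnWith
  let t' := t ∩ Metric.ball (prj (d+d) i q) 1
  have ht' : t' ∈ nhds (prj (d+d) i q) := inter_mem ht (Metric.ball_mem_nhds _ one_pos)
  refine ⟨gr (d+d) i c E '' t', ?_, ?_⟩
  · have hcont : ContinuousAt (prj (d+d) i) q := (prj_lip (d+d) i).continuous.continuousAt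
    have h1 : ∀ᶠ p in nhds q, prj (d+d) i p ∈ t' := hcont.eventually ht'
    have h2 : ∀ᶠ p in nhds q, 0 < p i * q i := by
      have : ContinuousAt (fun p : EuclideanSpace ℝ (Fin (d+d)) => p i * q i) q := by fun_prop
      exact this.eventually (lt_mem_nhds (by simpa using mul_self_pos.mpr hi))
    filter_upwards [mem_nhdsWithin_of_mem_nhds h1, mem_nhdsWithin_of_mem_nhds h2,
      self_mem_nhdsWithin] with p hp1 hp2 hp3
    refine ⟨prj (d+d) i p, hp1, ?_⟩
    ext j
    by_cases h : j = i
    · subst h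
      have hp3' : ∑ i, p i^2 = 2*E := hp3
      rw [sum_split _ j] at hp3'
      simp only [gr, dite_true]
      have : 2*E - ∑ k, prj (d+d) j p k^2 = p j^2 := by
        unfold prj
        linarith
      rw [this, Real.sqrt_sq_eq_abs]
      simp only [c]
      rcases lt_or_gt_of_ne hi with hn | hn
      · have : p j < 0 := by nlinarith
        rw [sign_neg hn, abs_of_neg this]; simp
      · have : 0 < p j := by nlinarith
        rw [sign_pos hn, abs_of_pos this]; simp
    · simp [gr, h, prj]
  · refine ((hK.mono Set.inter_subset_left).hausdorffMeasure_image_le (d := 2*(d:ℝ)-1)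
      (by have : (1:ℝ) ≤ d := by exact_mod_cast hd
          linarith)).trans_lt ?_
    rw [hm_eq d hd i]
    refine ENNReal.mul_lt_top (ENNReal.rpow_lt_top_of_nonneg (by
      have : (1:ℝ) ≤ d := by exact_mod_cast hd
      linarith) ENNReal.coe_ne_top) ?_
    exact (measure_mono Set.inter_subset_right).trans_lt measure_ball_lt_top

end

section
open MeasureTheory Real Filter
open scoped BigOperators ENNReal FourierTransform RealInnerProductSpace

lemma gamma_half (j : ℕ) : Real.Gamma ((j:ℝ) + 1/2) =
    ((2*j).factorial : ℝ) / (4^j * (j.factorial : ℝ)) * Real.sqrt π := by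
  induction j with
  | zero => simp [-one_div, Real.Gamma_one_half_eq]
  | succ j ih =>
    have : ((j+1 : ℕ):ℝ) + 1/2 = ((j:ℝ) + 1/2) + 1 := by push_cast; ring
    rw [this, Real.Gamma_add_one (by positivity), ih]
    have e : 2 * (j+1) = 2*j+1+1 := by ring
    rw [e, Nat.factorial_succ, Nat.factorial_succ, Nat.factorial_succ]
    push_cast
    field_simp
    ring

lemma rad_int (m : ℕ) : ∫ x in Set.Ioi (0:ℝ), x^m * Real.exp (-x^2) =
    1/2 * Real.Gamma (((m:ℝ)+1)/2) := by
  have := integral_rpow_mul_exp_neg_rpow (p := 2) (q := m) (by norm_num)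
    (by have : (0:ℝ) ≤ m := by positivity
        linarith)
  rw [← this]
  refine setIntegral_congr_fun measurableSet_Ioi fun x _ => ?_
  simp only [Real.rpow_natCast, Real.rpow_two]

lemma line_int (j : ℕ) : ∫ x : ℝ, x^(2*j) * Real.exp (-x^2) =
    ((2*j).factorial : ℝ) / (4^j * (j.factorial : ℝ)) * Real.sqrt π := by
  have h := integral_comp_abs (f := fun x : ℝ => x^(2*j) * Real.exp (-x^2))
  simp only [sq_abs, (even_two_mul j).pow_abs] at h
  rw [h, rad_int, ← gamma_half]
  have : (((2*j:ℕ):ℝ)+1)/2 = (j:ℝ) + 1/2 := by push_cast; ring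
  rw [this]; ring

lemma gaussB (d : ℕ) (hd : 1 ≤ d) (j : ℕ) :
    ∫ k : EuclideanSpace ℝ (Fin (d+d)), ‖k‖^(2*j) * Real.exp (-‖k‖^2) =
      π^d * (((d-1+j).factorial : ℝ) / ((d-1).factorial : ℝ)) := by
  have : Nontrivial (EuclideanSpace ℝ (Fin (d+d))) := by
    have : Nonempty (Fin (d+d)) := ⟨⟨0, by omega⟩⟩
    infer_instance
  have hr : ∀ j : ℕ, ∫ k : EuclideanSpace ℝ (Fin (d+d)), ‖k‖^(2*j) * Real.exp (-‖k‖^2) =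
      ((d+d : ℕ):ℝ) * (volume (Metric.ball (0:EuclideanSpace ℝ (Fin (d+d))) 1)).toReal
        * (1/2 * ((d-1+j).factorial : ℝ)) := by
    intro j
    have h := integral_fun_norm_addHaar (volume : Measure (EuclideanSpace ℝ (Fin (d+d))))
      (fun r : ℝ => r^(2*j) * Real.exp (-r^2))
    rw [h, finrank_euclideanSpace_fin]
    have e : ∫ y in Set.Ioi (0:ℝ), y ^ (d+d-1) • (y^(2*j) * Real.exp (-y^2)) =
        1/2 * ((d-1+j).factorial : ℝ) := by
      have := rad_int (d+d-1+2*j)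
      simp_rw [smul_eq_mul, ← mul_assoc, ← pow_add]
      rw [this, ← Real.Gamma_nat_eq_factorial]
      congr 2
      have e2 : d+d-1+2*j + 1= 2 * (d-1+j) + 2 := by omega
      have e3 : ((d+d-1+2*j : ℕ):ℝ) + 1 = 2 * ((d-1+j : ℕ):ℝ) + 2 := by exact_mod_cast e2
      rw [e3]; ring
    rw [e, nsmul_eq_mul, smul_eq_mul, ← mul_assoc]
    rfl
  have h0 := hr 0
  have h1 := GaussianFourier.integral_rexp_neg_mul_sq_norm (V := EuclideanSpace ℝ (Fin (d+d))) one_pos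
  simp only [mul_zero, pow_zero, one_mul, add_zero] at h0
  simp only [neg_mul, one_mul, finrank_euclideanSpace_fin, div_one] at h1
  rw [h1] at h0
  have e : ((d+d:ℕ):ℝ)/2 = d := by push_cast; ring
  rw [e, Real.rpow_natCast] at h0
  rw [hr j, h0]
  have := Nat.factorial_pos (d-1)
  field_simp

lemma exists_iso {n : ℕ} (u v : EuclideanSpace ℝ (Fin n)) (h : ‖u‖ = ‖v‖) :
    ∃ L : EuclideanSpace ℝ (Fin n) ≃ₗᵢ[ℝ] EuclideanSpace ℝ (Fin n), L u = v :=
  ⟨_, Submodule.reflection_sub h⟩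

lemma gaussA (d : ℕ) (hd : 1 ≤ d) (j : ℕ) (q : EuclideanSpace ℝ (Fin (d+d))) :
    ∫ k : EuclideanSpace ℝ (Fin (d+d)), ⟪k, q⟫^(2*j) * Real.exp (-‖k‖^2) =
      ‖q‖^(2*j) * (π^d * (((2*j).factorial : ℝ) / (4^j * (j.factorial : ℝ)))) := by
  let i : Fin (d+d) := ⟨0, by omega⟩
  obtain ⟨L, hL⟩ := exists_iso q (EuclideanSpace.single i ‖q‖) (by simp)
  have h1 : ∫ k : EuclideanSpace ℝ (Fin (d+d)), ⟪k, q⟫^(2*j) * Real.exp (-‖k‖^2) =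
      ∫ k : EuclideanSpace ℝ (Fin (d+d)), (‖q‖ * k i)^(2*j) * Real.exp (-‖k‖^2) := by
    rw [← L.measurePreserving.integral_comp L.toHomeomorph.measurableEmbedding
      (fun k => (‖q‖ * k i)^(2*j) * Real.exp (-‖k‖^2))]
    congr 1
    ext k
    rw [L.norm_map, ← L.inner_map_map k q, hL, EuclideanSpace.inner_single_right]
    simp
  rw [h1]
  simp_rw [mul_pow, mul_assoc]
  rw [integral_const_mul]
  congr 1
  rw [← (PiLp.volume_preserving_toLp (Fin (d+d))).integral_comp
     (MeasurableEquiv.toLp 2 _).measurableEmbedding]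
  have e : ∀ x : Fin (d+d) → ℝ, ((WithLp.toLp 2 x : EuclideanSpace ℝ (Fin (d+d))) i)^(2*j) *
      Real.exp (-‖(WithLp.toLp 2 x : EuclideanSpace ℝ (Fin (d+d)))‖^2) =
      ∏ l, ((if l = i then (x l)^(2*j) else 1) * Real.exp (-(x l)^2)) := by
    intro x
    rw [Finset.prod_mul_distrib, Finset.prod_ite_eq' , ← Real.exp_sum, EuclideanSpace.real_norm_sq_eq]
    simp
  refine (integral_congr_ae (Eventually.of_forall e)).trans ?_
  rw [integral_fintype_prod_volume_eq_prod (fun l (t:ℝ) => (if l = i then t^(2*j) else 1) * Real.exp (-t^2))]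
  rw [← Finset.mul_prod_erase _ _ (Finset.mem_univ i)]
  simp only [if_true]
  have h2 : ∏ l ∈ Finset.univ.erase i, ∫ t : ℝ, (if l = i then t^(2*j) else 1) * Real.exp (-t^2) =
      ∏ l ∈ (Finset.univ.erase i : Finset (Fin (d+d))), Real.sqrt π := by
    refine Finset.prod_congr rfl fun l hl => ?_
    have hl' : l ≠ i := Finset.ne_of_mem_erase hl
    simp only [hl', if_false, one_mul]
    simpa using integral_gaussian 1
  rw [h2, line_int, Finset.prod_const, Finset.card_erase_of_mem (Finset.mem_univ _), Finset.card_univ,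
    Fintype.card_fin]
  have h3 : Real.sqrt π * Real.sqrt π ^ (d+d-1) = π^d := by
    rw [← pow_succ']
    have : d + d - 1 + 1 = 2 * d := by omega
    rw [this, pow_mul, Real.sq_sqrt pi_pos.le]
  rw [mul_assoc, h3, mul_comm]

lemma gaussB_int (d : ℕ) (hd : 1 ≤ d) (j : ℕ) :
    Integrable (fun k : EuclideanSpace ℝ (Fin (d+d)) => ‖k‖^(2*j) * Real.exp (-‖k‖^2)) := by
  apply Integrable.of_integral_ne_zero
  rw [gaussB d hd]
  positivity

end

section
open MeasureTheory Real Filter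
open scoped BigOperators ENNReal FourierTransform RealInnerProductSpace

/-- surface measure -/
def sig (d : ℕ) (E : ℝ) : Measure (EuclideanSpace ℝ (Fin (d+d))) :=
  (μH[2 * (d:ℝ) - 1] : Measure (EuclideanSpace ℝ (Fin (d+d)))).restrict (energySurf d E)

lemma sig_finite (d : ℕ) (hd : 1 ≤ d) (E : ℝ) (hE : 0 < E) : IsFiniteMeasure (sig d E) :=
  ⟨by rw [sig, Measure.restrict_apply_univ]; exact surf_finite d hd E hE⟩

lemma sig_mp (d : ℕ) (E : ℝ) (L : EuclideanSpace ℝ (Fin (d+d)) ≃ₗᵢ[ℝ] EuclideanSpace ℝ (Fin (d+d))) :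
    MeasurePreserving L (sig d E) (sig d E) := by
  have h := (L.toIsometryEquiv.measurePreserving_hausdorffMeasure (2*(d:ℝ)-1)).restrict_preimage
    (surf_closed d E).measurableSet
  have e : L.toIsometryEquiv ⁻¹' (energySurf d E) = energySurf d E := by
    ext q
    rw [Set.mem_preimage, surf_norm, surf_norm]
    simp
  rw [e] at h
  exact h

lemma sig_comp (d : ℕ) (E : ℝ) (L : EuclideanSpace ℝ (Fin (d+d)) ≃ₗᵢ[ℝ] EuclideanSpace ℝ (Fin (d+d)))
    (F : EuclideanSpace ℝ (Fin (d+d)) → ℝ) : ∫ q, F (L q) ∂(sig d E) = ∫ q, F q ∂(sig d E) :=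
  (sig_mp d E L).integral_comp L.toHomeomorph.measurableEmbedding F

lemma mom_radial (d : ℕ) (E : ℝ) (m : ℕ) (k k' : EuclideanSpace ℝ (Fin (d+d))) (h : ‖k‖ = ‖k'‖) :
    ∫ q, ⟪k, q⟫^m ∂(sig d E) = ∫ q, ⟪k', q⟫^m ∂(sig d E) := by
  obtain ⟨L, hL⟩ := exists_iso k k' h
  rw [← sig_comp d E L (fun q => ⟪k', q⟫^m), ← hL]
  simp_rw [L.inner_map_map]

lemma sin_int_zero (d : ℕ) (E : ℝ) (k : EuclideanSpace ℝ (Fin (d+d))) :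
    ∫ q, Real.sin ⟪k, q⟫ ∂(sig d E) = 0 := by
  have := sig_comp d E (LinearIsometryEquiv.neg ℝ) (fun q => Real.sin ⟪k, q⟫)
  simp only [LinearIsometryEquiv.coe_neg, inner_neg_right, Real.sin_neg, integral_neg] at this
  linarith

lemma sig_ae (d : ℕ) (E : ℝ) : ∀ᵐ q ∂(sig d E), ‖q‖^2 = 2*E := by
  refine (ae_restrict_mem (surf_closed d E).measurableSet).mono fun q hq => ?_
  rwa [surf_norm] at hq

lemma sig_int (d : ℕ) (hd : 1 ≤ d) (E : ℝ) (hE : 0 < E) {F : Type*} [NormedAddCommGroup F]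
    (f : EuclideanSpace ℝ (Fin (d+d)) → F) (hf : Continuous f) : Integrable f (sig d E) :=
  by
  have : IntegrableOn f (energySurf d E) (μH[2 * (d:ℝ) - 1]) := by
    obtain ⟨C, hC⟩ := (surf_compact d E).exists_bound_of_continuousOn hf.continuousOn
    exact IntegrableOn.of_bound (surf_finite d hd E hE) 
      (hf.continuousOn.aestronglyMeasurable_of_isCompact (surf_compact d E) (surf_closed d E).measurableSet) C
      ((ae_restrict_mem (surf_closed d E).measurableSet).mono hC)
  exact this

lemma moment (d : ℕ) (hd : 1 ≤ d) (E : ℝ) (hE : 0 < E) (j : ℕ) (k : EuclideanSpace ℝ (Fin (d+d))) :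
    ∫ q, ⟪k, q⟫^(2*j) ∂(sig d E) = (sig d E).real Set.univ * (‖k‖^(2*j) * (2*E)^j *
      (((2*j).factorial : ℝ) / (4^j * (j.factorial : ℝ))) *
      (((d-1).factorial : ℝ) / ((d-1+j).factorial : ℝ))) := by
  have := sig_finite d hd E hE
  let i : Fin (d+d) := ⟨0, by omega⟩
  set c := ∫ q, ⟪(EuclideanSpace.single i 1 : EuclideanSpace ℝ (Fin (d+d))), q⟫^(2*j) ∂(sig d E) with hc
  have h1 : ∀ k : EuclideanSpace ℝ (Fin (d+d)), ∫ q, ⟪k, q⟫^(2*j) ∂(sig d E) = ‖k‖^(2*j) * c := by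
    intro k
    rw [mom_radial d E (2*j) k (‖k‖ • EuclideanSpace.single i 1) (by simp [norm_smul]), hc,
      ← integral_const_mul]
    simp_rw [real_inner_smul_left, mul_pow]
  have h2 : ∫ k : EuclideanSpace ℝ (Fin (d+d)), (∫ q, ⟪k, q⟫^(2*j) * Real.exp (-‖k‖^2) ∂(sig d E)) =
      ∫ q, (∫ k : EuclideanSpace ℝ (Fin (d+d)), ⟪k, q⟫^(2*j) * Real.exp (-‖k‖^2)) ∂(sig d E) := by
    refine integral_integral_swap ?_
    have hb : Integrable (fun p : EuclideanSpace ℝ (Fin (d+d)) × EuclideanSpace ℝ (Fin (d+d)) =>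
      (‖p.1‖^(2*j) * Real.exp (-‖p.1‖^2)) * ‖p.2‖^(2*j)) (volume.prod (sig d E)) :=
      (gaussB_int d hd j).mul_prod (sig_int d hd E hE (fun q => ‖q‖^(2*j)) (by fun_prop))
    refine hb.mono' (Continuous.aestronglyMeasurable (by fun_prop)) (Eventually.of_forall fun p => ?_)
    simp only [Function.uncurry]
    rw [norm_mul, norm_pow, Real.norm_eq_abs (Real.exp _), Real.abs_exp]
    calc _ ≤ (‖p.1‖ * ‖p.2‖)^(2*j) * Real.exp (-‖p.1‖^2) := by
            gcongr
            exact norm_inner_le_norm _ _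
      _ = _ := by rw [mul_pow]; ring
  simp_rw [integral_mul_const, h1, gaussA d hd j] at h2
  have h3 : ∫ k : EuclideanSpace ℝ (Fin (d+d)), ‖k‖^(2*j) * c * Real.exp (-‖k‖^2) =
      c * (π^d * (((d-1+j).factorial : ℝ) / ((d-1).factorial : ℝ))) := by
    rw [← gaussB d hd, ← integral_const_mul]
    congr 1; ext k; ring
  have h4 : ∫ q, ‖q‖^(2*j) ∂(sig d E) = (sig d E).real Set.univ * (2*E)^j := by
    rw [integral_congr_ae (g := fun _ => (2*E)^j)]
    · simp
    · filter_upwards [sig_ae d E] with q hq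
      rw [pow_mul, hq]
  rw [h3, integral_mul_const, h4] at h2
  rw [h1]
  have hp : π ≠ 0 := pi_pos.ne'
  have f1 := Nat.factorial_pos (d-1)
  have f2 := Nat.factorial_pos (d-1+j)
  have f3 := Nat.factorial_pos j
  have h5 : c = (sig d E).real Set.univ * (2*E)^j * (((2*j).factorial : ℝ) / (4^j * (j.factorial : ℝ))) *
      (((d-1).factorial : ℝ) / ((d-1+j).factorial : ℝ)) := by
    field_simp at h2 ⊢
    linarith
  rw [h5]; ring

lemma cos_int (d : ℕ) (hd : 1 ≤ d) (E : ℝ) (hE : 0 < E) (k : EuclideanSpace ℝ (Fin (d+d))) :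
    ∫ q, Real.cos ⟪k, q⟫ ∂(sig d E) = (sig d E).real Set.univ * Psi d (E * (‖k‖^2/2)) := by
  have key : ∀ j : ℕ, ∫ q, ⟪k, q⟫^(2*j) / ((2*j).factorial : ℝ) ∂(sig d E) =
      (sig d E).real Set.univ * (((d-1).factorial : ℝ) / ((d-1+j).factorial : ℝ) *
        ((E * (‖k‖^2/2))^j / (j.factorial : ℝ))) := by
    intro j
    rw [integral_div, moment d hd E hE]
    have : (E * (‖k‖^2/2))^j = ‖k‖^(2*j) * (2*E)^j / 4^j := by
      rw [pow_mul, ← mul_pow, ← div_pow]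
      congr 1; ring
    rw [this]
    field_simp
  have h := hasSum_integral_of_summable_integral_norm (μ := sig d E)
    (F := fun (j:ℕ) q => (-1)^j * ⟪k, q⟫^(2*j) / ((2*j).factorial : ℝ)) ?_ ?_
  · simp_rw [fun q => (Real.hasSum_cos ⟪k, q⟫).tsum_eq] at h
    rw [← h.tsum_eq, Psi, ← tsum_mul_left]
    congr 1; ext j
    simp_rw [mul_div_assoc]
    rw [integral_const_mul]
    rw [key, neg_pow (E * (‖k‖^2/2))]
    ring
  · intro j
    exact sig_int d hd E hE _ (by fun_prop)
  · have : ∀ j : ℕ, ∫ q, ‖(-1)^j * ⟪k, q⟫^(2*j) / ((2*j).factorial : ℝ)‖ ∂(sig d E) =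
      ∫ q, ⟪k, q⟫^(2*j) / ((2*j).factorial : ℝ) ∂(sig d E) := by
      intro j
      congr 1; ext q
      rw [norm_div, norm_mul, norm_pow, norm_neg, norm_one, one_pow, one_mul, Real.norm_eq_abs,
        abs_of_nonneg ((even_two_mul j).pow_nonneg _), Real.norm_natCast]
    simp_rw [this, key]
    refine Summable.mul_left _ ?_
    refine Summable.of_nonneg_of_le (fun j => by positivity) (fun j => ?_)
      (Real.summable_pow_div_factorial (E * (‖k‖^2/2)))
    have a2 : ((d-1).factorial : ℝ) / ((d-1+j).factorial : ℝ) ≤ 1 := by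
      rw [div_le_one (by positivity)]
      exact_mod_cast Nat.factorial_le (by omega)
    exact mul_le_of_le_one_left (by positivity) a2

lemma sig_char (d : ℕ) (hd : 1 ≤ d) (E : ℝ) (hE : 0 < E) (k : EuclideanSpace ℝ (Fin (d+d))) :
    ∫ q, Complex.exp (Complex.I * ((⟪k, q⟫ : ℝ) : ℂ)) ∂(sig d E) =
      (((sig d E).real Set.univ * Psi d (E * (‖k‖^2/2)) : ℝ) : ℂ) := by
  have e : ∀ q : EuclideanSpace ℝ (Fin (d+d)), Complex.exp (Complex.I * ((⟪k, q⟫ : ℝ) : ℂ)) =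
      ((Real.cos ⟪k, q⟫ : ℝ) : ℂ) + ((Real.sin ⟪k, q⟫ : ℝ) : ℂ) * Complex.I := by
    intro q
    rw [mul_comm, Complex.exp_mul_I, Complex.ofReal_cos, Complex.ofReal_sin]
  simp_rw [e]
  rw [integral_add (sig_int d hd E hE _ (by fun_prop)) (sig_int d hd E hE _ (by fun_prop)),
    integral_mul_const, integral_complex_ofReal, integral_complex_ofReal, cos_int d hd E hE, sin_int_zero]
  simp

end

section
open MeasureTheory Real Filter
open scoped BigOperators ENNReal FourierTransform RealInnerProductSpace

/-- split as measurable equivalence -/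
def splitE (d : ℕ) : EuclideanSpace ℝ (Fin (d+d)) ≃ᵐ (Fin d → ℝ) × (Fin d → ℝ) :=
  (MeasurableEquiv.toLp 2 (Fin (d+d) → ℝ)).symm.trans
    ((MeasurableEquiv.piCongrLeft (fun _ => ℝ) (finSumFinEquiv (m := d) (n := d))).symm.trans
      (MeasurableEquiv.sumPiEquivProdPi (fun _ => ℝ)))

lemma splitE_coe (d : ℕ) (q : EuclideanSpace ℝ (Fin (d+d))) : splitE d q = splitPt d q := rfl

lemma splitE_mp (d : ℕ) : MeasurePreserving (splitE d) volume volume :=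
  ((volume_measurePreserving_sumPiEquivProdPi (fun _ => ℝ)).comp
    (volume_measurePreserving_piCongrLeft (fun _ => ℝ) (finSumFinEquiv (m := d) (n := d))).symm).comp
    (PiLp.volume_preserving_ofLp (Fin (d+d)))

lemma split_integral (d : ℕ) (F : (Fin d → ℝ) × (Fin d → ℝ) → ℂ) :
    ∫ p, F p = ∫ q, F (splitPt d q) :=
  ((splitE_mp d).integral_comp (splitE d).measurableEmbedding F).symm

lemma split_integrable (d : ℕ) (F : (Fin d → ℝ) × (Fin d → ℝ) → ℂ) (h : Integrable F) :
    Integrable (fun q => F (splitPt d q)) :=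
  ((splitE_mp d).integrable_comp_emb (splitE d).measurableEmbedding).mpr h

lemma split_contDiff (d : ℕ) : ContDiff ℝ (⊤ : ℕ∞) (splitPt d) := by
  unfold splitPt
  fun_prop

lemma wigQ_integrable (d : ℕ) (hd : 1 ≤ d) (hb : ℝ) (hhb : 0 < hb) (N : ℕ) :
    Integrable (fun q => wigner d hb N (splitPt d q).1 (splitPt d q).2) :=
  split_integrable d _ (wigner_integrable d hd hb hhb N)

lemma wigQ_char (d : ℕ) (hd : 1 ≤ d) (hb : ℝ) (hhb : 0 < hb) (N : ℕ) (K : EuclideanSpace ℝ (Fin (d+d))) :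
    ∫ q, wigner d hb N (splitPt d q).1 (splitPt d q).2 * Complex.exp (Complex.I * ((⟪K, q⟫ : ℝ) : ℂ)) =
      ((EL d N (hb/2 * ‖K‖^2) : ℝ) : ℂ) := by
  have h := wigner_char d hd hb hhb N (splitPt d K).1 (splitPt d K).2
  rw [split_integral] at h
  have e : (∑ j, (splitPt d K).1 j^2) + ∑ j, (splitPt d K).2 j^2 = ‖K‖^2 := by
    rw [EuclideanSpace.real_norm_sq_eq, Fin.sum_univ_add]; rfl
  rw [e] at h
  rw [← h]
  congr 1; ext q
  congr 4
  rw [PiLp.inner_apply, Fin.sum_univ_add, Finset.sum_add_distrib]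
  simp [splitPt, mul_comm]

lemma rep (n : ℕ) (f : EuclideanSpace ℝ (Fin n) → ℂ) (hf : ContDiff ℝ (⊤ : ℕ∞) f)
    (hc : HasCompactSupport f) : ∃ fh : EuclideanSpace ℝ (Fin n) → ℂ, Integrable fh ∧
      ∀ q, f q = ∫ k, fh k * Complex.exp (Complex.I * ((⟪(2*π)•k, q⟫ : ℝ) : ℂ)) := by
  let g := hc.toSchwartzMap hf
  have hg : (g : EuclideanSpace ℝ (Fin n) → ℂ) = f := rfl
  refine ⟨𝓕 f, ?_, ?_⟩
  · have := (𝓕 g).integrable (μ := volume)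
    rwa [SchwartzMap.fourier_coe, hg] at this
  · intro q
    have h := g.continuous.fourierInv_fourier_eq g.integrable
      (by have := (𝓕 g).integrable (μ := volume)
          rwa [SchwartzMap.fourier_coe] at this)
    rw [hg] at h
    conv_lhs => rw [← h]
    rw [Real.fourierInv_eq']
    congr 1; ext k
    rw [smul_eq_mul, mul_comm, real_inner_smul_left, mul_comm Complex.I]

lemma limit_cpt (d : ℕ) (hd : 1 ≤ d) (E : ℝ) (hE : 0 < E) (f : EuclideanSpace ℝ (Fin (d+d)) → ℂ)
    (hf : ContDiff ℝ (⊤ : ℕ∞) f) (hc : HasCompactSupport f) :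
    Tendsto (fun N : ℕ => ((((N + d - 1).choose (d - 1) : ℝ)⁻¹ : ℝ) : ℂ) *
      ∫ q, f q * wigner d (hPl d E N) N (splitPt d q).1 (splitPt d q).2) atTop
      (nhds (((((sig d E).real Set.univ)⁻¹ : ℝ) : ℂ) * ∫ q, f q ∂(sig d E))) := by
  have := sig_finite d hd E hE
  have hsp : (sig d E).real Set.univ ≠ 0 := by
    rw [sig, measureReal_def, Measure.restrict_apply_univ]
    exact (ENNReal.toReal_pos (surf_pos d hd E hE).ne' (surf_finite d hd E hE).ne).ne'
  obtain ⟨fh, hfh, hrep⟩ := rep _ f hf hc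
  have hexp : ∀ k q : EuclideanSpace ℝ (Fin (d+d)), ‖Complex.exp (Complex.I * ((⟪(2*π)•k, q⟫ : ℝ) : ℂ))‖ = 1 := by
    intro k q
    rw [mul_comm, Complex.norm_exp_ofReal_mul_I]
  have fub : ∀ (μ : Measure (EuclideanSpace ℝ (Fin (d+d)))) [SFinite μ]
      (W : EuclideanSpace ℝ (Fin (d+d)) → ℂ), Integrable W μ →
      ∫ q, f q * W q ∂μ = ∫ k, fh k * ∫ q, W q *
        Complex.exp (Complex.I * ((⟪(2*π)•k, q⟫ : ℝ) : ℂ)) ∂μ := by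
    intro μ _ W hW
    simp_rw [hrep, ← integral_mul_const, ← integral_const_mul]
    rw [integral_integral_swap]
    · congr 1; ext k
      congr 1; ext q
      ring
    · have h1 := hW.mul_prod hfh
      refine Integrable.mono h1 ?_ ?_
      · refine AEStronglyMeasurable.mul (AEStronglyMeasurable.mul ?_ ?_) ?_
        · exact hfh.1.comp_snd
        · exact Continuous.aestronglyMeasurable (by fun_prop)
        · exact hW.1.comp_fst
      · refine Eventually.of_forall fun p => ?_
        simp only [Function.uncurry]
        rw [norm_mul, norm_mul, hexp, norm_mul]
        linarith
  have hN : ∀ N : ℕ, ((((N + d - 1).choose (d - 1) : ℝ)⁻¹ : ℝ) : ℂ) *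
      ∫ q, f q * wigner d (hPl d E N) N (splitPt d q).1 (splitPt d q).2 =
      ∫ k, fh k * ((((N + d - 1).choose (d - 1) : ℝ)⁻¹ *
        EL d N (hPl d E N * (‖(2*π)•k‖^2/2)) : ℝ) : ℂ) := by
    intro N
    rw [fub volume _ (wigQ_integrable d hd _ (hPl_pos d hd E hE N) N), ← integral_const_mul]
    congr 1; ext k
    rw [wigQ_char d hd _ (hPl_pos d hd E hE N)]
    have : hPl d E N / 2 * ‖(2*π)•k‖^2 = hPl d E N * (‖(2*π)•k‖^2/2) := by ring
    rw [this]
    push_cast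
    ring
  have hL : ((((sig d E).real Set.univ)⁻¹ : ℝ) : ℂ) * ∫ q, f q ∂(sig d E) =
      ∫ k, fh k * ((Psi d (E * (‖(2*π)•k‖^2/2)) : ℝ) : ℂ) := by
    have h1 := fub (sig d E) (fun _ => 1) (integrable_const _)
    simp only [mul_one, one_mul] at h1
    rw [h1, ← integral_const_mul]
    congr 1; ext k
    rw [sig_char d hd E hE]
    push_cast
    have : (((sig d E).real Set.univ : ℝ) : ℂ) ≠ 0 := by exact_mod_cast hsp
    field_simp
  simp_rw [hN]
  rw [hL]
  refine tendsto_integral_of_dominated_convergence (fun k => ‖fh k‖) ?_ hfh.norm ?_ ?_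
  · intro N
    refine hfh.1.mul (Continuous.aestronglyMeasurable ?_)
    unfold EL lag
    fun_prop
  · intro N
    refine Eventually.of_forall fun k => ?_
    rw [norm_mul, Complex.norm_real, Real.norm_eq_abs, abs_mul]
    refine mul_le_of_le_one_right (norm_nonneg _) ?_
    have hp := hPl_pos d hd E hE N
    have h1 := EL_le d N hd (hPl d E N * (‖(2*π)•k‖^2/2)) (by positivity)
    have hcp : 0 < ((N + d - 1).choose (d - 1) : ℝ) := by
      exact_mod_cast Nat.choose_pos (by omega)
    rw [abs_of_pos (inv_pos.mpr hcp), inv_mul_le_iff₀ hcp, mul_one]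
    exact h1
  · refine Eventually.of_forall fun k => ?_
    refine Tendsto.const_mul _ ?_
    exact (Complex.continuous_ofReal.tendsto _).comp (EL_tendsto d hd E hE _ (by positivity))

end

section
open MeasureTheory Real Filter
open scoped BigOperators ENNReal FourierTransform RealInnerProductSpace

lemma norm_sq_le (d : ℕ) (p : (Fin d → ℝ) × (Fin d → ℝ)) :
    ‖p‖^2 ≤ (∑ j, p.1 j^2) + ∑ j, p.2 j^2 := by
  have h0 : 0 ≤ (∑ j, p.1 j^2) + ∑ j, p.2 j^2 := by positivity
  rw [← Real.le_sqrt (norm_nonneg _) h0]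
  refine norm_prod_le_iff.mpr ⟨?_, ?_⟩
  · refine (pi_norm_le_iff_of_nonneg (Real.sqrt_nonneg _)).mpr fun j => Real.le_sqrt_of_sq_le ?_
    rw [Real.norm_eq_abs, sq_abs]
    have h1 := Finset.single_le_sum (f := fun j => p.1 j^2) (fun i _ => sq_nonneg _) (Finset.mem_univ j)
    have h2 : 0 ≤ ∑ j, p.2 j^2 := by positivity
    linarith
  · refine (pi_norm_le_iff_of_nonneg (Real.sqrt_nonneg _)).mpr fun j => Real.le_sqrt_of_sq_le ?_
    rw [Real.norm_eq_abs, sq_abs]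
    have h1 := Finset.single_le_sum (f := fun j => p.2 j^2) (fun i _ => sq_nonneg _) (Finset.mem_univ j)
    have h2 : 0 ≤ ∑ j, p.1 j^2 := by positivity
    linarith

lemma tail_bound (d : ℕ) (hd : 1 ≤ d) (E : ℝ) (hE : 0 < E) (b : (Fin d → ℝ) × (Fin d → ℝ) → ℝ)
    (C : ℝ) (hC : ∀ p, |b p| ≤ C) (hb0 : ∀ p, ‖p‖^2 ≤ 12*E → b p = 0) (N : ℕ) :
    ‖∫ p : (Fin d → ℝ) × (Fin d → ℝ), (b p : ℂ) * wigner d (hPl d E N) N p.1 p.2‖ ≤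
      C * 2^d * 2^(d-1) * (16 * Real.exp (-3))^N := by
  have hp := hPl_pos d hd E hE N
  set h := hPl d E N with hh
  have hC0 : 0 ≤ C := (abs_nonneg _).trans (hC 0)
  obtain ⟨g1, g2⟩ := gauss_phase d (1/(2*h)) (by positivity)
  set A := C * (((π*h)⁻¹)^d * (2^(d-1) * 16^N * Real.exp (-(3*E/h)))) with hA
  have hpt : ∀ p : (Fin d → ℝ) × (Fin d → ℝ), ‖(b p : ℂ) * wigner d h N p.1 p.2‖ ≤
      A * Real.exp (-(1/(2*h)) * ((∑ j, p.1 j^2) + ∑ j, p.2 j^2)) := by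
    intro p
    by_cases hs : ‖p‖^2 ≤ 12*E
    · rw [hb0 p hs]
      simp only [Complex.ofReal_zero, zero_mul, norm_zero]
      positivity
    · push Not at hs
      have hS := norm_sq_le d p
      set S := (∑ j, p.1 j^2) + ∑ j, p.2 j^2
      have hw := wigner_bound d hd h hp N p.1 p.2
      rw [norm_mul, Complex.norm_real, Real.norm_eq_abs]
      calc _ ≤ C * (((π*h)⁻¹)^d * (2^(d-1) * 16^N * Real.exp (-(3/(4*h)) * S))) := by
            gcongr
            exact hC p
        _ ≤ C * (((π*h)⁻¹)^d * (2^(d-1) * 16^N * (Real.exp (-(3*E/h)) * Real.exp (-(1/(2*h)) * S)))) := by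
            gcongr
            rw [← Real.exp_add]
            refine Real.exp_le_exp.mpr ?_
            have e1 : -(3*E/h) + -(1/(2*h)) * S - -(3/(4*h)) * S = (S - 12*E) / (4*h) := by
              field_simp; ring
            have e2 : 0 ≤ (S - 12*E) / (4*h) := div_nonneg (by linarith) (by positivity)
            linarith
        _ = _ := by rw [hA]; ring
  refine (norm_integral_le_of_norm_le (g1.const_mul A) (Eventually.of_forall hpt)).trans ?_
  rw [integral_const_mul, g2, hA]
  have e1 : π / (1/(2*h)) = 2 * (π*h) := by field_simp
  have e2 : 3*E/h = 3 * N + 3 * d/2 := by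
    rw [hh, hPl]
    have : (N:ℝ) + d/2 ≠ 0 := by positivity
    field_simp
  rw [e1, e2, mul_pow 2 (π*h)]
  have e3 : Real.exp (-(3 * (N:ℝ) + 3 * d/2)) ≤ (Real.exp (-3))^N := by
    rw [← Real.exp_nat_mul]
    refine Real.exp_le_exp.mpr ?_
    have : 0 ≤ 3 * (d:ℝ)/2 := by positivity
    linarith
  have e4 : ((π*h)⁻¹)^d * (π*h)^d = 1 := by
    rw [← mul_pow, inv_mul_cancel₀ (by positivity), one_pow]
  calc _ = C * 2^d * 2^(d-1) * (16^N * Real.exp (-(3 * (N:ℝ) + 3 * d/2))) *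
        (((π*h)⁻¹)^d * (π*h)^d) := by ring
    _ ≤ _ := by
      rw [e4, mul_one, mul_pow]
      gcongr

lemma tail_tendsto (d : ℕ) (hd : 1 ≤ d) (E : ℝ) (hE : 0 < E) (b : (Fin d → ℝ) × (Fin d → ℝ) → ℝ)
    (C : ℝ) (hC : ∀ p, |b p| ≤ C) (hb0 : ∀ p, ‖p‖^2 ≤ 12*E → b p = 0) :
    Tendsto (fun N : ℕ => ((((N + d - 1).choose (d - 1) : ℝ)⁻¹ : ℝ) : ℂ) *
      ∫ p : (Fin d → ℝ) × (Fin d → ℝ), (b p : ℂ) * wigner d (hPl d E N) N p.1 p.2) atTop (nhds 0) := by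
  have h16 : 16 * Real.exp (-3) < 1 := by
    rw [Real.exp_neg, ← div_eq_mul_inv, div_lt_one (Real.exp_pos _)]
    have h1 := Real.exp_one_gt_d9
    have h2 : Real.exp 3 = Real.exp 1 ^ 3 := by rw [← Real.exp_nat_mul]; norm_num
    rw [h2]
    calc (16:ℝ) < 2.7^3 := by norm_num
      _ ≤ _ := by gcongr; linarith
  have hlim : Tendsto (fun N : ℕ => C * 2^d * 2^(d-1) * (16 * Real.exp (-3))^N) atTop (nhds 0) := by
    have := (tendsto_pow_atTop_nhds_zero_of_lt_one (by positivity) h16).const_mul (C * 2^d * 2^(d-1))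
    simpa using this
  refine squeeze_zero_norm (fun N => ?_) hlim
  refine le_trans ?_ (tail_bound d hd E hE b C hC hb0 N)
  rw [norm_mul, Complex.norm_real]
  refine mul_le_of_le_one_left (norm_nonneg _) ?_
  have hcp : (1:ℝ) ≤ ((N + d - 1).choose (d - 1) : ℝ) := by
    exact_mod_cast Nat.choose_pos (by omega)
  rw [Real.norm_eq_abs, abs_of_nonneg (by positivity)]
  exact inv_le_one_of_one_le₀ hcp

lemma split_norm_le (d : ℕ) (q : EuclideanSpace ℝ (Fin (d+d))) : ‖splitPt d q‖^2 ≤ ‖q‖^2 := by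
  refine (norm_sq_le d _).trans (le_of_eq ?_)
  rw [EuclideanSpace.real_norm_sq_eq, Fin.sum_univ_add]; rfl

lemma norm_split_le (d : ℕ) (q : EuclideanSpace ℝ (Fin (d+d))) : 
    ‖q‖^2 ≤ ((d+d : ℕ):ℝ) * ‖splitPt d q‖^2 := by
  have h1 : ∀ i, q (Fin.castAdd d i)^2 ≤ ‖splitPt d q‖^2 := by
    intro i
    rw [← sq_abs]
    gcongr
    exact (norm_le_pi_norm (splitPt d q).1 i).trans (norm_fst_le _)
  have h2 : ∀ i, q (Fin.natAdd d i)^2 ≤ ‖splitPt d q‖^2 := by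
    intro i
    rw [← sq_abs]
    gcongr
    exact (norm_le_pi_norm (splitPt d q).2 i).trans (norm_snd_le _)
  rw [EuclideanSpace.real_norm_sq_eq, Fin.sum_univ_add]
  refine (add_le_add (Finset.sum_le_sum fun i _ => h1 i) (Finset.sum_le_sum fun i _ => h2 i)).trans ?_
  simp
  linarith

end

/-- **Weak* limit of normalized Wigner distributions.** For a smooth symbol `a₀` with all
derivatives bounded, the normalized Wigner distributions of the eigenspace projections
(at `ħ = ħ_N(E)`) converge to the normalized Liouville (surface) measure of `Σ_E`. -/
theorem wigner_weakstar_limit (d : ℕ) (hd : 1 ≤ d) (E : ℝ) (hE : 0 < E)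
    (a₀ : (Fin d → ℝ) × (Fin d → ℝ) → ℝ)
    (hsmooth : ContDiff ℝ (⊤ : ℕ∞) a₀)
    (hbdd : ∀ n : ℕ, ∃ C : ℝ, ∀ p, ‖iteratedFDeriv ℝ n a₀ p‖ ≤ C) :
    Filter.Tendsto (fun N : ℕ =>
        ((((N + d - 1).choose (d - 1) : ℝ)⁻¹ : ℝ) : ℂ) *
          ∫ p : (Fin d → ℝ) × (Fin d → ℝ), (a₀ p : ℂ) * wigner d (hPl d E N) N p.1 p.2)
      Filter.atTop
      (nhds (Complex.ofReal
        ((μH[2 * (d : ℝ) - 1] (energySurf d E)).toReal⁻¹ *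
          ∫ q in energySurf d E, a₀ (splitPt d q) ∂μH[2 * (d : ℝ) - 1]))) := by
  obtain ⟨C, hC⟩ := hbdd 0
  have hC' : ∀ p, |a₀ p| ≤ C := by
    intro p
    have := hC p
    rwa [norm_iteratedFDeriv_zero, Real.norm_eq_abs] at this
  have hr : 0 < Real.sqrt (12*E) := Real.sqrt_pos.mpr (by positivity)
  let χ : ContDiffBump (0 : (Fin d → ℝ) × (Fin d → ℝ)) := ⟨Real.sqrt (12*E), Real.sqrt (12*E) + 1, hr, by linarith⟩
  have hχ1 : ∀ p, ‖p‖^2 ≤ 12*E → χ p = 1 := by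
    intro p hp
    refine χ.one_of_mem_closedBall ?_
    rw [mem_closedBall_zero_iff]
    exact Real.le_sqrt_of_sq_le hp
  let f : EuclideanSpace ℝ (Fin (d+d)) → ℂ := fun q => ((a₀ (splitPt d q) * χ (splitPt d q) : ℝ) : ℂ)
  have hfs : ContDiff ℝ (⊤ : ℕ∞) f := by
    have h1 : ContDiff ℝ (⊤ : ℕ∞) (fun p => a₀ p * χ p) := hsmooth.mul χ.contDiff
    exact Complex.ofRealCLM.contDiff.comp (h1.comp (split_contDiff d))
  have hfc : HasCompactSupport f := by
    refine HasCompactSupport.of_support_subset_isCompact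
      (isCompact_closedBall (0 : EuclideanSpace ℝ (Fin (d+d)))
        (Real.sqrt (((d+d : ℕ):ℝ) * (Real.sqrt (12*E) + 1)^2))) ?_
    intro q hq
    have hq1 : χ (splitPt d q) ≠ 0 := by
      intro h0
      apply hq
      simp [f, h0]
    have hq2 : splitPt d q ∈ Metric.ball 0 (Real.sqrt (12*E) + 1) := by
      rw [← χ.support_eq]
      exact hq1
    rw [mem_ball_zero_iff] at hq2
    rw [mem_closedBall_zero_iff]
    refine Real.le_sqrt_of_sq_le ((norm_split_le d q).trans ?_)
    gcongr
  have h1 := limit_cpt d hd E hE f hfs hfc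
  have h2 := tail_tendsto d hd E hE (fun p => a₀ p * (1 - χ p)) C (by
    intro p
    rw [abs_mul]
    have hC0 : 0 ≤ C := (abs_nonneg _).trans (hC' 0)
    calc _ ≤ C * 1 := by
          gcongr
          · exact hC' p
          · rw [abs_le]
            have := χ.nonneg (x := p)
            have := χ.le_one (x := p)
            constructor <;> linarith
      _ = C := mul_one C) (by
    intro p hp
    simp [hχ1 p hp])
  have h3 := h1.add h2
  rw [add_zero] at h3
  have hlim : ((((sig d E).real Set.univ)⁻¹ : ℝ) : ℂ) * ∫ q, f q ∂(sig d E) =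
      Complex.ofReal
        ((μH[2 * (d : ℝ) - 1] (energySurf d E)).toReal⁻¹ *
          ∫ q in energySurf d E, a₀ (splitPt d q) ∂μH[2 * (d : ℝ) - 1]) := by
    rw [Complex.ofReal_mul, ← integral_complex_ofReal]
    congr 1
    · rw [sig, measureReal_def, Measure.restrict_apply_univ]
    · rw [sig]
      refine setIntegral_congr_fun (surf_closed d E).measurableSet fun q hq => ?_
      simp only [f]
      rw [hχ1, mul_one]
      rw [surf_norm] at hq
      have := split_norm_le d q
      linarith
  rw [hlim] at h3
  refine h3.congr fun N => ?_
  have hp := hPl_pos d hd E hE N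
  rw [← mul_add]
  congr 1
  have hW := wigner_integrable d hd _ hp N
  have hint : ∀ b : (Fin d → ℝ) × (Fin d → ℝ) → ℝ, Continuous b → (∀ p, |b p| ≤ C) →
      Integrable (fun p : (Fin d → ℝ) × (Fin d → ℝ) => (b p : ℂ) * wigner d (hPl d E N) N p.1 p.2) := by
    intro b hb hbC
    refine hW.bdd_mul (c := C) (Continuous.aestronglyMeasurable (by fun_prop)) (Eventually.of_forall fun p => ?_)
    rw [Complex.norm_real]
    exact hbC p
  have hac := hsmooth.continuous
  have hχc := χ.continuous
  have hs : ∫ q, f q * wigner d (hPl d E N) N (splitPt d q).1 (splitPt d q).2 =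
      ∫ p : (Fin d → ℝ) × (Fin d → ℝ), ((a₀ p * χ p : ℝ) : ℂ) * wigner d (hPl d E N) N p.1 p.2 :=
    (split_integral d (fun p => ((a₀ p * χ p : ℝ) : ℂ) * wigner d (hPl d E N) N p.1 p.2)).symm
  rw [hs, ← integral_add]
  · congr 1; ext p
    push_cast
    ring
  · refine hint (fun p => a₀ p * χ p) (by fun_prop) fun p => ?_
    rw [abs_mul, abs_of_nonneg χ.nonneg]
    exact (mul_le_of_le_one_right (abs_nonneg _) χ.le_one).trans (hC' p)
  · refine hint (fun p => a₀ p * (1 - χ p)) (by fun_prop) fun p => ?_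
    rw [abs_mul, abs_of_nonneg (sub_nonneg.mpr χ.le_one)]
    refine (mul_le_of_le_one_right (abs_nonneg _) ?_).trans (hC' p)
    linarith [χ.nonneg (x := p)]
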